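/- arXiv:1301.6875 — 2 statements merged into one kernel-verified Lean document; each statement's English description precedes it below -/
import Mathlib

section
/- Let O and O′ be maximal orders of B_p with successive minima D₁ ≤ D₂ ≤ D₃ of O^T realized by x, y, z and D₁′ ≤ D₂′ ≤ D₃′ of O′^T realized by x′, y′, z′. Assume 8 ≤ D₁ and D₂′ ≤ D₂. Then |Tr(x·ȳ)| < D₁, |Tr(x′·ȳ′)| < D₁′, and D₁ ≠ D₂. -/
open scoped Quaternion

/-- The rational quaternion algebra with `i² = -p`, `j² = -q`. -/
abbrev Bq (p q : ℕ) := ℍ[ℚ, -(p : ℚ), -(q : ℚ)]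

namespace GrossPaper

variable {p q : ℕ}

/-- The (reduced) trace `Tr(x) = x + x̄` of a quaternion, as a rational number. -/
def Trq (x : Bq p q) : ℚ := 2 * x.re

/-- The (reduced) norm `Nr(x) = x·x̄` of a quaternion, as a rational number. -/
def Nrq (x : Bq p q) : ℚ := (x * star x).re

/-- The inverse of a nonzero quaternion: `c⁻¹ = star c / Nr c`. -/
noncomputable def qinv (c : Bq p q) : Bq p q := (Nrq c)⁻¹ • star c

/-- Conjugation of a set: `c S c⁻¹`. -/
noncomputable def conjSet (c : Bq p q) (S : Set (Bq p q)) : Set (Bq p q) :=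
  (fun s => c * s * qinv c) '' S

/-- An order of `B_p`: a subring (hence containing `ℤ`) which is a free `ℤ`-module of
rank 4 spanning `B_p` over `ℚ`. -/
def IsOrder (O : Subring (Bq p q)) : Prop :=
  Nonempty (Module.Basis (Fin 4) ℤ O) ∧ Submodule.span ℚ (O : Set (Bq p q)) = ⊤

/-- A maximal order: an order not properly contained in any other order. -/
def IsMaximalOrder (O : Subring (Bq p q)) : Prop :=
  IsOrder O ∧ ∀ O' : Subring (Bq p q), IsOrder O' → O ≤ O' → O' = O

/-- Two orders are of the same type if they are conjugate. -/
noncomputable def SameType (O O' : Subring (Bq p q)) : Prop :=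
  ∃ c : Bq p q, c ≠ 0 ∧ conjSet c (O : Set (Bq p q)) = (O' : Set (Bq p q))

/-- The Gross lattice `O^T = {2x - Tr(x) : x ∈ O}`. -/
def GrossLat (O : Subring (Bq p q)) : Set (Bq p q) :=
  {t | ∃ x ∈ O, t = 2 * x - algebraMap ℚ (Bq p q) (Trq x)}

/-- `SuccMin T i D` says `D` is the `i`-th successive minimum of `T`: the least real
number such that `T` contains `i` `ℚ`-linearly independent elements of norm at most `D`. -/
def SuccMin (T : Set (Bq p q)) (i : ℕ) (D : ℝ) : Prop :=
  IsLeast {r : ℝ | ∃ v : Fin i → Bq p q, (∀ n, v n ∈ T) ∧ LinearIndependent ℚ v ∧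
    ∀ n, ((Nrq (v n) : ℝ) ≤ r)} D

/-- A primitive element of the Gross lattice. -/
def Primitive (T : Set (Bq p q)) (t : Bq p q) : Prop :=
  t ∈ T ∧ t ≠ 0 ∧ ∀ (a : ℤ) (s : Bq p q), s ∈ T → t = a • s → a = 1 ∨ a = -1

/-- `k` is represented optimally by `T` : `Nr(t) = k` for some primitive `t ∈ T`. -/
def OptRep (T : Set (Bq p q)) (k : ℝ) : Prop :=
  ∃ t : Bq p q, Primitive T t ∧ (Nrq t : ℝ) = k

/-- The multiplicity `θ_T(k)`: half the number of `t ∈ T` with `Nr t = k`. -/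
noncomputable def theta (T : Set (Bq p q)) (k : ℝ) : ℚ :=
  ({t : Bq p q | t ∈ T ∧ (Nrq t : ℝ) = k}.ncard : ℚ) / 2

/-- The optimal multiplicity `θ'_T(k)`: half the number of primitive `t ∈ T` with `Nr t = k`. -/
noncomputable def thetaOpt (T : Set (Bq p q)) (k : ℝ) : ℚ :=
  ({t : Bq p q | Primitive T t ∧ (Nrq t : ℝ) = k}.ncard : ℚ) / 2

end GrossPaper

namespace GrossPaper

lemma Nrq_eq {p q : ℕ} (u : Bq p q) :
    Nrq u = u.re ^ 2 + p * u.imI ^ 2 + q * u.imJ ^ 2 + p * q * u.imK ^ 2 := by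
  simp [Nrq]; ring

lemma Trq_bil {p q : ℕ} (u v : Bq p q) :
    Trq (u * star v) = 2 * (u.re * v.re + p * (u.imI * v.imI) + q * (u.imJ * v.imJ)
      + p * q * (u.imK * v.imK)) := by
  simp [Trq]; ring

lemma Nrq_mul {p q : ℕ} (u v : Bq p q) : Nrq (u * v) = Nrq u * Nrq v := by
  simp only [Nrq_eq]; simp; ring

lemma Nrq_star {p q : ℕ} (u : Bq p q) : Nrq (star u) = Nrq u := by
  simp only [Nrq_eq]; simp

lemma Nrq_smul {p q : ℕ} (c : ℚ) (u : Bq p q) : Nrq (c • u) = c ^ 2 * Nrq u := by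
  simp only [Nrq_eq]; simp; ring

lemma Nrq_add {p q : ℕ} (u v : Bq p q) :
    Nrq (u + v) = Nrq u + Nrq v + Trq (u * star v) := by
  simp only [Nrq_eq, Trq_bil]; simp; ring

lemma Nrq_one {p q : ℕ} : Nrq (1 : Bq p q) = 1 := by
  simp only [Nrq_eq]; simp

lemma Nrq_pow {p q : ℕ} (u : Bq p q) (n : ℕ) : Nrq (u ^ n) = Nrq u ^ n := by
  induction n with
  | zero => simp [Nrq_one]
  | succ k ih => rw [pow_succ, Nrq_mul, ih, pow_succ]

lemma Nrq_nonneg {p q : ℕ} (u : Bq p q) : 0 ≤ Nrq u := by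
  rw [Nrq_eq]; positivity

lemma Nrq_eq_zero {p q : ℕ} (hp : 0 < p) (hq : 0 < q) (u : Bq p q) (h : Nrq u = 0) : u = 0 := by
  have hp' : (0 : ℚ) < p := by exact_mod_cast hp
  have hq' : (0 : ℚ) < q := by exact_mod_cast hq
  rw [Nrq_eq] at h
  have h0 : 0 ≤ u.re ^ 2 := by positivity
  have h1 : 0 ≤ p * u.imI ^ 2 := by positivity
  have h2 : 0 ≤ q * u.imJ ^ 2 := by positivity
  have h3 : 0 ≤ p * q * u.imK ^ 2 := by positivity
  have e0 : u.re ^ 2 = 0 := by linarith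
  have e1 : p * u.imI ^ 2 = 0 := by linarith
  have e2 : q * u.imJ ^ 2 = 0 := by linarith
  have e3 : p * q * u.imK ^ 2 = 0 := by linarith
  ext
  · simpa using e0
  · simpa [hp'.ne'] using e1
  · simpa [hq'.ne'] using e2
  · simpa [hq'.ne', hp'.ne'] using e3

/-- bounded denominators -/
lemma fg_den {p q : ℕ} (M : Submodule ℤ (Bq p q)) (hM : M.FG) :
    ∃ N : ℕ, 0 < N ∧ ∀ a ∈ M, ∃ n : ℤ, (N : ℚ) * Nrq a = n := by
  suffices h : ∃ N : ℕ, 0 < N ∧ ∀ a ∈ M, ∃ c0 c1 c2 c3 : ℤ,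
      (N : ℚ) * a.re = c0 ∧ (N : ℚ) * a.imI = c1 ∧ (N : ℚ) * a.imJ = c2 ∧ (N : ℚ) * a.imK = c3 by
    obtain ⟨N, hN, h⟩ := h
    refine ⟨N ^ 2, by positivity, fun a ha => ?_⟩
    obtain ⟨c0, c1, c2, c3, h0, h1, h2, h3⟩ := h a ha
    refine ⟨c0 ^ 2 + p * c1 ^ 2 + q * c2 ^ 2 + p * q * c3 ^ 2, ?_⟩
    push_cast
    rw [Nrq_eq, ← h0, ← h1, ← h2, ← h3]; ring
  induction M, hM using Submodule.fg_induction with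
  | singleton x =>
    refine ⟨x.re.den * x.imI.den * x.imJ.den * x.imK.den, ?_, ?_⟩
    · have := x.re.den_pos; have := x.imI.den_pos; have := x.imJ.den_pos; have := x.imK.den_pos
      positivity
    · intro a ha
      obtain ⟨n, rfl⟩ := Submodule.mem_span_singleton.1 ha
      refine ⟨n * x.re.num * x.imI.den * x.imJ.den * x.imK.den,
        n * x.re.den * x.imI.num * x.imJ.den * x.imK.den,
        n * x.re.den * x.imI.den * x.imJ.num * x.imK.den,
        n * x.re.den * x.imI.den * x.imJ.den * x.imK.num, ?_, ?_, ?_, ?_⟩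
      · have := Rat.den_mul_eq_num x.re
        push_cast
        rw [show (n • x).re = (n : ℚ) * x.re by simp]
        linear_combination ((n : ℚ) * x.imI.den * x.imJ.den * x.imK.den) * this
      · have := Rat.den_mul_eq_num x.imI
        push_cast
        rw [show (n • x).imI = (n : ℚ) * x.imI by simp]
        linear_combination ((n : ℚ) * x.re.den * x.imJ.den * x.imK.den) * this
      · have := Rat.den_mul_eq_num x.imJ
        push_cast
        rw [show (n • x).imJ = (n : ℚ) * x.imJ by simp]
        linear_combination ((n : ℚ) * x.re.den * x.imI.den * x.imK.den) * this
      · have := Rat.den_mul_eq_num x.imK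
        push_cast
        rw [show (n • x).imK = (n : ℚ) * x.imK by simp]
        linear_combination ((n : ℚ) * x.re.den * x.imI.den * x.imJ.den) * this
  | sup M₁ M₂ _ _ h1 h2 =>
    obtain ⟨N, hN, h⟩ := h1
    obtain ⟨N', hN', h'⟩ := h2
    refine ⟨N * N', by positivity, fun a ha => ?_⟩
    obtain ⟨y, hy, z, hz, rfl⟩ := Submodule.mem_sup.1 ha
    obtain ⟨c0, c1, c2, c3, e0, e1, e2, e3⟩ := h y hy
    obtain ⟨d0, d1, d2, d3, f0, f1, f2, f3⟩ := h' z hz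
    refine ⟨N' * c0 + N * d0, N' * c1 + N * d1, N' * c2 + N * d2, N' * c3 + N * d3, ?_, ?_, ?_, ?_⟩
    · push_cast; rw [← e0, ← f0]; simp; ring
    · push_cast; rw [← e1, ← f1]; simp; ring
    · push_cast; rw [← e2, ← f2]; simp; ring
    · push_cast; rw [← e3, ← f3]; simp; ring

lemma rat_int_of_pow (r : ℚ) (N : ℕ) (hN : 0 < N) (h : ∀ k : ℕ, ∃ n : ℤ, (N : ℚ) * r ^ k = n) :
    ∃ n : ℤ, r = n := by
  have hd : ∀ k : ℕ, r.den ^ k ∣ N := by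
    intro k
    obtain ⟨n, hn⟩ := h k
    have h1 : ((N : ℤ) * r.num ^ k : ℤ) = n * (r.den : ℤ) ^ k := by
      have : (r.den : ℚ) ≠ 0 := by exact_mod_cast r.den_nz
      have h2 : (N : ℚ) * (r.num : ℚ) ^ k = n * (r.den : ℚ) ^ k := by
        rw [← hn, ← Rat.den_mul_eq_num r, mul_pow]; ring
      exact_mod_cast h2
    have h3 : ((r.den : ℤ) ^ k) ∣ (N : ℤ) * r.num ^ k := ⟨n, by rw [h1]; ring⟩
    have h4 : IsCoprime ((r.den : ℤ) ^ k) (r.num ^ k) := by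
      apply IsCoprime.pow
      rw [Int.isCoprime_iff_gcd_eq_one, Int.gcd_comm]
      exact r.reduced
    have := h4.dvd_of_dvd_mul_right h3
    exact_mod_cast this
  have h1 : r.den = 1 := by
    by_contra hne
    have h2 : 1 < r.den := by have := r.den_pos; omega
    have h3 := Nat.le_of_dvd hN (hd N)
    exact absurd h3 (not_le.2 (Nat.lt_pow_self h2))
  exact ⟨r.num, by rw [← Rat.den_mul_eq_num r, h1]; simp⟩

def subm {p q : ℕ} (O : Subring (Bq p q)) : Submodule ℤ (Bq p q) :=
  AddSubgroup.toIntSubmodule O.toAddSubgroup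

lemma mem_subm {p q : ℕ} {O : Subring (Bq p q)} {a : Bq p q} : a ∈ subm O ↔ a ∈ O := Iff.rfl

lemma subm_fg {p q : ℕ} {O : Subring (Bq p q)} (hO : IsOrder O) : (subm O).FG := by
  obtain ⟨⟨b⟩, -⟩ := hO
  rw [← Module.Finite.iff_fg]
  have : Module.Finite ℤ O := Module.Finite.of_basis b
  exact this

lemma order_norm {p q : ℕ} {O : Subring (Bq p q)} (hO : IsOrder O) {a : Bq p q} (ha : a ∈ O) :
    ∃ n : ℤ, Nrq a = n := by
  obtain ⟨N, hN, h⟩ := fg_den _ (subm_fg hO)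
  apply rat_int_of_pow _ N hN
  intro k
  rw [← Nrq_pow]
  exact h _ (mem_subm.2 (pow_mem ha k))

lemma order_trace {p q : ℕ} {O : Subring (Bq p q)} (hO : IsOrder O) {a : Bq p q} (ha : a ∈ O) :
    ∃ n : ℤ, Trq a = n := by
  obtain ⟨n, hn⟩ := order_norm hO ha
  obtain ⟨m, hm⟩ := order_norm hO (add_mem ha (one_mem O))
  rw [Nrq_add, hn, Nrq_one] at hm
  refine ⟨m - n - 1, ?_⟩
  simp at hm
  push_cast; linarith

lemma order_bil {p q : ℕ} {O : Subring (Bq p q)} (hO : IsOrder O) {a b : Bq p q} (ha : a ∈ O)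
    (hb : b ∈ O) : ∃ n : ℤ, Trq (a * star b) = n := by
  obtain ⟨n, hn⟩ := order_norm hO ha
  obtain ⟨l, hl⟩ := order_norm hO hb
  obtain ⟨m, hm⟩ := order_norm hO (add_mem ha hb)
  rw [Nrq_add, hn, hl] at hm
  refine ⟨m - n - l, ?_⟩
  push_cast; linarith

/-- a finitely generated subring spanning over ℚ is an order -/
lemma isOrder_of_fg {p q : ℕ} (O : Subring (Bq p q)) (h : (subm O).FG)
    (hs : Submodule.span ℚ (O : Set (Bq p q)) = ⊤) : IsOrder O := by
  refine ⟨?_, hs⟩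
  have hf : Module.Finite ℤ (subm O) := Module.Finite.iff_fg.2 h
  have htf : IsAddTorsionFree (Bq p q) := IsAddTorsionFree.of_module_rat _
  have hfr : Module.Free ℤ (subm O) := inferInstance
  let b := Module.Free.chooseBasis ℤ (subm O)
  have li : LinearIndependent ℤ (fun i => (b i : Bq p q)) :=
    b.linearIndependent.map' (subm O).subtype (Submodule.ker_subtype _)
  have li' : LinearIndependent ℚ (fun i => (b i : Bq p q)) :=
    (LinearIndependent.iff_fractionRing ℤ ℚ).1 li
  have hspan : ⊤ ≤ Submodule.span ℚ (Set.range (fun i => (b i : Bq p q))) := by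
    rw [← hs, Submodule.span_le]
    intro a ha
    have h1 := b.sum_repr ⟨a, ha⟩
    have h2 : a = ∑ i, (b.repr ⟨a, ha⟩ i) • (b i : Bq p q) := by
      have := congrArg (subm O).subtype h1
      rw [map_sum] at this
      simp only [map_smul] at this
      exact this.symm
    rw [h2]
    refine sum_mem fun i _ => ?_
    have := Submodule.smul_mem (Submodule.span ℚ (Set.range (fun i => (b i : Bq p q))))
      ((b.repr ⟨a, ha⟩ i : ℤ) : ℚ) (Submodule.subset_span ⟨i, rfl⟩)
    rwa [Int.cast_smul_eq_zsmul] at this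
  have c := Module.finrank_eq_card_basis (Module.Basis.mk li' hspan)
  rw [QuaternionAlgebra.finrank_eq_four] at c
  exact ⟨b.reindex (Fintype.equivFinOfCardEq c.symm)⟩

end GrossPaper
namespace GrossPaper

/-- p-integral rationals -/
noncomputable def pInt (p : ℕ) [Fact p.Prime] : Subring ℚ :=
  (PadicInt.subring p).comap (algebraMap ℚ ℚ_[p])

lemma mem_pInt {p : ℕ} [Fact p.Prime] {r : ℚ} : r ∈ pInt p ↔ ‖(r : ℚ_[p])‖ ≤ 1 := by
  simp [pInt, PadicInt.mem_subring_iff]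

lemma int_mem_pInt {p : ℕ} [Fact p.Prime] (n : ℤ) : (n : ℚ) ∈ pInt p := by
  exact intCast_mem _ n

lemma pInt_dvd {p : ℕ} [hp : Fact p.Prime] {n : ℤ} {r : ℚ} (hr : r ∈ pInt p) (h : (n : ℚ) = p * r) :
    (p : ℤ) ∣ n := by
  rw [mem_pInt] at hr
  have h1 : ((n : ℤ) : ℚ_[p]) = p * (r : ℚ_[p]) := by exact_mod_cast congrArg (Rat.cast : ℚ → ℚ_[p]) h
  rw [← Padic.norm_intCast_lt_one_iff, h1, norm_mul]
  have : ‖(p : ℚ_[p])‖ < 1 := Padic.norm_p_lt_one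
  nlinarith [norm_nonneg (p : ℚ_[p]), norm_nonneg (r : ℚ_[p])]

lemma int_of_pInt {p : ℕ} [hp : Fact p.Prime] {r : ℚ} (hr : r ∈ pInt p)
    (h : ∃ n : ℤ, p * r = n) : ∃ n : ℤ, r = n := by
  obtain ⟨n, hn⟩ := h
  obtain ⟨m, rfl⟩ := pInt_dvd hr hn.symm
  refine ⟨m, ?_⟩
  have : (p : ℚ) ≠ 0 := by exact_mod_cast hp.out.ne_zero
  push_cast at hn
  exact mul_left_cancel₀ this hn

lemma pInt_of_mul {p : ℕ} [hp : Fact p.Prime] {r : ℚ} {m : ℤ} (hm : ¬ (p : ℤ) ∣ m)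
    (h : m * r ∈ pInt p) : r ∈ pInt p := by
  rw [mem_pInt] at *
  push_cast at h
  rw [norm_mul] at h
  have : ‖(m : ℚ_[p])‖ = 1 := by
    have h1 := Padic.norm_int_le_one (p := p) m
    have h2 := mt (Padic.norm_intCast_lt_one_iff (p := p) (k := m)).1 hm
    linarith [not_lt.1 h2]
  simpa [this] using h

/-- for p-integral `r`, `r² / p` p-integral implies `r / p` p-integral. Stated with quotients. -/
lemma padic_aniso {p : ℕ} [hp : Fact p.Prime] (α : ℤ) (hα : ¬ IsSquare (-(α : ZMod p)))
    (X Y W V : ℤ_[p]) (h : Y ^ 2 + p * (α * X ^ 2 + W ^ 2) = p ^ 2 * V) :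
    (p : ℤ_[p]) ∣ X ∧ (p : ℤ_[p]) ∣ Y ∧ (p : ℤ_[p]) ∣ W := by
  have hpr : Prime (p : ℤ_[p]) := PadicInt.prime_p
  have hY : (p : ℤ_[p]) ∣ Y := by
    apply hpr.dvd_of_dvd_pow (n := 2)
    exact ⟨p * V - (α * X ^ 2 + W ^ 2), by linear_combination h⟩
  obtain ⟨Y', rfl⟩ := hY
  have h2 : α * X ^ 2 + W ^ 2 = p * (V - Y' ^ 2) := by
    apply mul_left_cancel₀ hpr.ne_zero
    linear_combination h
  have key : ∀ T : ℤ_[p], (p : ℤ_[p]) ∣ T ↔ PadicInt.toZMod T = 0 := by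
    intro T
    rw [← RingHom.mem_ker, PadicInt.ker_toZMod, PadicInt.maximalIdeal_eq_span_p,
      Ideal.mem_span_singleton]
  have h3 := congrArg (PadicInt.toZMod (p := p)) h2
  simp only [map_add, map_mul, map_pow, map_intCast, map_natCast, CharP.cast_eq_zero, zero_mul] at h3
  have hX : PadicInt.toZMod X = 0 := by
    by_contra hne
    apply hα
    refine ⟨PadicInt.toZMod W / PadicInt.toZMod X, ?_⟩
    field_simp
    linear_combination -h3
  have hW : PadicInt.toZMod W = 0 := by
    rw [hX] at h3
    simpa using h3
  exact ⟨(key _).2 hX, ⟨Y', rfl⟩, (key _).2 hW⟩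

lemma aniso_aux {p : ℕ} [hp : Fact p.Prime] (α : ℤ) (hα : ¬ IsSquare (-(α : ZMod p))) (t : ℕ) :
    ∀ (X Y W : ℚ), (p ^ t * X ∈ pInt p) → (p ^ t * Y ∈ pInt p) → (p ^ t * W ∈ pInt p) →
      Y ^ 2 + p * (α * X ^ 2 + W ^ 2) ∈ pInt p → X ∈ pInt p ∧ Y ∈ pInt p ∧ W ∈ pInt p := by
  induction t with
  | zero => intro X Y W h1 h2 h3 _; simp at *; exact ⟨h1, h2, h3⟩
  | succ t ih =>
    intro X Y W h1 h2 h3 h4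
    have hp0 : (p : ℚ_[p]) ≠ 0 := by exact_mod_cast hp.out.ne_zero
    rw [mem_pInt] at h1 h2 h3
    have h4' := mem_pInt.1 h4
    have tp : (p : ℚ_[p]) ^ (2 * t) * ((Y ^ 2 + p * (α * X ^ 2 + W ^ 2) : ℚ) : ℚ_[p])
        ∈ PadicInt.subring p := by
      apply mul_mem
      · apply pow_mem; exact natCast_mem _ _
      · exact h4'
    obtain ⟨X', hX⟩ : ∃ X' : ℤ_[p], (X' : ℚ_[p]) = ((p ^ (t+1) * X : ℚ) : ℚ_[p]) := ⟨⟨_, h1⟩, rfl⟩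
    obtain ⟨Y', hY⟩ : ∃ X' : ℤ_[p], (X' : ℚ_[p]) = ((p ^ (t+1) * Y : ℚ) : ℚ_[p]) := ⟨⟨_, h2⟩, rfl⟩
    obtain ⟨W', hW⟩ : ∃ X' : ℤ_[p], (X' : ℚ_[p]) = ((p ^ (t+1) * W : ℚ) : ℚ_[p]) := ⟨⟨_, h3⟩, rfl⟩
    obtain ⟨V', hV⟩ : ∃ X' : ℤ_[p], (X' : ℚ_[p]) = (p : ℚ_[p]) ^ (2 * t) * ((Y ^ 2 + p * (α * X ^ 2 + W ^ 2) : ℚ) : ℚ_[p]) := ⟨⟨_, tp⟩, rfl⟩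
    have := padic_aniso α hα X' Y' W' V' (by
      apply Subtype.ext
      push_cast
      rw [hX, hY, hW, hV]
      push_cast
      ring)
    have key : ∀ (Z : ℚ) (Z' : ℤ_[p]) (hZ : (Z' : ℚ_[p]) = ((p ^ (t+1) * Z : ℚ) : ℚ_[p])),
        (p : ℤ_[p]) ∣ Z' → p ^ t * Z ∈ pInt p := by
      rintro Z Z' hZ ⟨c, rfl⟩
      rw [mem_pInt]
      push_cast at hZ
      have : ((p ^ t * Z : ℚ) : ℚ_[p]) = c := by
        push_cast
        apply mul_left_cancel₀ hp0
        rw [hZ]; ring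
      rw [this]
      exact c.2
    exact ih X Y W (key _ _ hX this.1) (key _ _ hY this.2.1) (key _ _ hW this.2.2) h4

lemma exists_pow_pInt {p : ℕ} [hp : Fact p.Prime] (X : ℚ) : ∃ t : ℕ, ∀ s ≥ t, p ^ s * X ∈ pInt p := by
  have h : Filter.Tendsto (fun s : ℕ => ‖((p ^ s * X : ℚ) : ℚ_[p])‖) Filter.atTop (nhds 0) := by
    have h1 : Filter.Tendsto (fun s : ℕ => ‖(p : ℚ_[p])‖ ^ s * ‖(X : ℚ_[p])‖) Filter.atTop (nhds (0 * ‖(X : ℚ_[p])‖)) :=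
      (tendsto_pow_atTop_nhds_zero_of_lt_one (norm_nonneg _) Padic.norm_p_lt_one).mul_const _
    rw [zero_mul] at h1
    refine h1.congr fun s => ?_
    push_cast
    rw [norm_mul, norm_pow]
  have h2 := h.eventually (gt_mem_nhds (show (0 : ℝ) < 1 by norm_num))
  obtain ⟨t, ht⟩ := Filter.eventually_atTop.1 h2
  exact ⟨t, fun s hs => mem_pInt.2 (ht s hs).le⟩

lemma aniso {p : ℕ} [hp : Fact p.Prime] (α : ℤ) (hα : ¬ IsSquare (-(α : ZMod p)))
    (X Y W : ℚ) (h : Y ^ 2 + p * (α * X ^ 2 + W ^ 2) ∈ pInt p) :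
    X ∈ pInt p ∧ Y ∈ pInt p ∧ W ∈ pInt p := by
  obtain ⟨a, ha⟩ := exists_pow_pInt (p := p) X
  obtain ⟨b, hb⟩ := exists_pow_pInt (p := p) Y
  obtain ⟨c, hc⟩ := exists_pow_pInt (p := p) W
  exact aniso_aux α hα (a + b + c) X Y W (ha _ (by omega)) (hb _ (by omega)) (hc _ (by omega)) h

lemma nonsq {p q : ℕ} (hp : p.Prime) (hodd : Odd p) (hq : q.Prime) (hq8 : q % 8 = 3)
    (hqr : ∃ r : ℤ, (q : ℤ) ∣ r ^ 2 + p) (hne : p ≠ q) : ¬ IsSquare (-(q : ZMod p)) := by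
  have : Fact p.Prime := ⟨hp⟩
  have : Fact q.Prime := ⟨hq⟩
  have hp2 : p % 2 = 1 := Nat.odd_iff.1 hodd
  obtain ⟨r, hr⟩ := hqr
  have hr' : ((r ^ 2 + p : ℤ) : ZMod q) = 0 := (ZMod.intCast_zmod_eq_zero_iff_dvd _ _).2 hr
  push_cast at hr'
  have hpq0 : ((p : ℤ) : ZMod q) ≠ 0 := by
    intro h
    rw [ZMod.intCast_zmod_eq_zero_iff_dvd] at h
    have := (Nat.prime_dvd_prime_iff_eq hq hp).1 (by exact_mod_cast h)
    exact hne this.symm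
  have hqp0 : ((q : ℤ) : ZMod p) ≠ 0 := by
    intro h
    rw [ZMod.intCast_zmod_eq_zero_iff_dvd] at h
    have := (Nat.prime_dvd_prime_iff_eq hp hq).1 (by exact_mod_cast h)
    exact hne this
  -- legendre (−p / q) = 1
  have h1 : legendreSym q (-p) = 1 := by
    rw [legendreSym.eq_one_iff]
    · refine ⟨(r : ZMod q), ?_⟩
      push_cast
      linear_combination -hr'
    · push_cast; push_cast at hpq0; simpa using hpq0
  intro hsq
  have h2 : legendreSym p (-q) = 1 := by
    rw [legendreSym.eq_one_iff]
    · push_cast; exact hsq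
    · push_cast; push_cast at hqp0; simpa using hqp0
  have hrec := legendreSym.quadratic_reciprocity (p := p) (q := q) (by rintro rfl; omega) (by rintro rfl; omega) hne
  rw [show (-(p : ℤ)) = (-1) * p by ring, legendreSym.mul, legendreSym.at_neg_one (by rintro rfl; omega)] at h1
  rw [show (-(q : ℤ)) = (-1) * q by ring, legendreSym.mul, legendreSym.at_neg_one (by rintro rfl; omega)] at h2
  rw [ZMod.χ₄_eq_neg_one_pow hp2] at h2
  rw [ZMod.χ₄_eq_neg_one_pow (by omega)] at h1
  have hq2 : Odd (q / 2) := by rw [Nat.odd_iff]; omega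
  rw [hq2.neg_one_pow] at h1
  rw [mul_comm (p / 2), pow_mul, hq2.neg_one_pow] at hrec
  generalize (-1 : ℤ) ^ (p / 2) = e at *
  generalize legendreSym p q = A at *
  generalize legendreSym q p = B at *
  have hB : B = -1 := by linarith
  subst hB
  have : e * e = -1 := by linear_combination (-1) * h2 - e * hrec
  nlinarith [mul_self_nonneg e]

lemma nonsq_one {p : ℕ} (hp : p.Prime) (h : p % 8 = 3) : ¬ IsSquare (-(1 : ZMod p)) := by
  have : Fact p.Prime := ⟨hp⟩
  rw [ZMod.exists_sq_eq_neg_one_iff]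
  omega

/-- Main local lemma. -/
lemma local_main {p q : ℕ} [hp : Fact p.Prime] (hodd : Odd p) (hq : q.Prime) (hq8 : q % 8 = 3)
    (hqr : ∃ r : ℤ, (q : ℤ) ∣ r ^ 2 + p) (z : Bq p q) (hN : Nrq z ∈ pInt p) (hT : Trq z ∈ pInt p) :
    z.re ∈ pInt p ∧ z.imI ∈ pInt p ∧ z.imJ ∈ pInt p ∧ q * z.imK ∈ pInt p := by
  have h2 : ¬ (p : ℤ) ∣ 2 := by
    intro h
    have := (Nat.prime_dvd_prime_iff_eq hp.out Nat.prime_two).1 (by exact_mod_cast h)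
    subst this
    exact absurd hodd (by decide)
  have h0 : z.re ∈ pInt p := pInt_of_mul h2 (by simpa [Trq] using hT)
  refine ⟨h0, ?_⟩
  rw [Nrq_eq] at hN
  have hN' := sub_mem hN (pow_mem h0 2)
  by_cases hpq : p = q
  · subst hpq
    have := aniso (p := p) 1 (by simpa using nonsq_one hp.out hq8) z.imI (p * z.imK) z.imJ (by
      convert hN' using 1; push_cast; ring)
    exact ⟨this.1, this.2.2, this.2.1⟩
  · have hqp : ¬ (p : ℤ) ∣ q := by
      intro h
      exact hpq ((Nat.prime_dvd_prime_iff_eq hp.out hq).1 (by exact_mod_cast h))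
    have := aniso (p := p) q (by simpa using nonsq hp.out hodd hq hq8 hqr hpq) z.imI (q * z.imJ) (q * z.imK) (by
      convert mul_mem (int_mem_pInt q) hN' using 1; push_cast; ring)
    exact ⟨this.1, pInt_of_mul hqp (by exact_mod_cast this.2.1), this.2.2⟩

/-- p divides the Gram determinant of two trace-zero elements. -/
lemma local_dvd {p q : ℕ} [hp : Fact p.Prime] (hodd : Odd p) (hq : q.Prime) (hq8 : q % 8 = 3)
    (hqr : ∃ r : ℤ, (q : ℤ) ∣ r ^ 2 + p) (x y : Bq p q) (hx : x.re = 0) (hy : y.re = 0)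
    (a b s : ℤ) (ha : Nrq x = a) (hb : Nrq y = b) (hs : Trq (x * star y) = 2 * s) :
    (p : ℤ) ∣ a * b - s ^ 2 := by
  obtain ⟨-, x1, x2, x3⟩ := local_main hodd hq hq8 hqr x (ha ▸ int_mem_pInt a)
    (by simp [Trq, hx])
  obtain ⟨-, y1, y2, y3⟩ := local_main hodd hq hq8 hqr y (hb ▸ int_mem_pInt b)
    (by simp [Trq, hy])
  rw [Nrq_eq, hx] at ha
  rw [Nrq_eq, hy] at hb
  rw [Trq_bil, hx] at hs
  have hs' : (s : ℚ) = p * (x.imI * y.imI) + q * (x.imJ * y.imJ) + p * q * (x.imK * y.imK) := by linarith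
  have hq0 : (q : ℚ) ≠ 0 := by exact_mod_cast hq.ne_zero
  have hp0 : (p : ℚ) ≠ 0 := by exact_mod_cast hp.out.ne_zero
  have m23 := sub_mem (mul_mem x2 y3) (mul_mem x3 y2)
  have m13 := sub_mem (mul_mem x1 y3) (mul_mem x3 y1)
  have m12 := sub_mem (mul_mem x1 y2) (mul_mem x2 y1)
  have hpi := int_mem_pInt (p := p) p
  have hqi := int_mem_pInt (p := p) q
  push_cast at hpi hqi
  by_cases hpq : p = q
  · subst hpq
    apply pInt_dvd (add_mem (add_mem (pow_mem m23 2) (pow_mem m13 2)) (mul_mem hpi (pow_mem m12 2)))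
    push_cast
    rw [← ha, ← hb, hs']
    ring
  · have hqp : ¬ (p : ℤ) ∣ q := by
      intro h
      exact hpq ((Nat.prime_dvd_prime_iff_eq hp.out hq).1 (by exact_mod_cast h))
    have : (p : ℤ) ∣ q * (a * b - s ^ 2) := by
      apply pInt_dvd (add_mem (add_mem (mul_mem hqi (pow_mem m23 2)) (mul_mem hpi (pow_mem m13 2))) (mul_mem (mul_mem hqi hqi) (pow_mem m12 2)))
      push_cast
      rw [← ha, ← hb, hs']
      ring
    exact ((Nat.prime_iff_prime_int.1 hp.out).dvd_or_dvd this).resolve_left hqp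

end GrossPaper
namespace GrossPaper

def el (p q : ℕ) (r : ℤ) (m : Fin 4 → ℚ) : Bq p q :=
  ⟨m 0 + m 1 / 2, m 2 / 2, m 1 / 2 + r * m 3 / q, m 2 / 2 + m 3 / q⟩

def fb (p q : ℕ) (r : ℤ) (i : Fin 4) : Bq p q := el p q r (Pi.single i 1)

def O0 (p q : ℕ) (r : ℤ) : Submodule ℤ (Bq p q) := Submodule.span ℤ (Set.range (fb p q r))

lemma mem_O0 {p q : ℕ} {r : ℤ} {z : Bq p q} :
    z ∈ O0 p q r ↔ ∃ m : Fin 4 → ℤ, z = el p q r (fun i => (m i : ℚ)) := by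
  rw [O0, Submodule.mem_span_range_iff_exists_fun]
  have : ∀ m : Fin 4 → ℤ, ∑ i, m i • fb p q r i = el p q r (fun i => (m i : ℚ)) := by
    intro m
    rw [Fin.sum_univ_four]
    ext <;> simp [fb, el] <;> ring
  constructor
  · rintro ⟨m, rfl⟩; exact ⟨m, this m⟩
  · rintro ⟨m, rfl⟩; exact ⟨m, this m⟩

lemma fb_mem {p q : ℕ} {r : ℤ} (i : Fin 4) : fb p q r i ∈ O0 p q r :=
  Submodule.subset_span ⟨i, rfl⟩

lemma fb_zero {p q : ℕ} {r : ℤ} : fb p q r 0 = 1 := by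
  ext <;> simp [fb, el]

lemma O0_fg {p q : ℕ} {r : ℤ} : (O0 p q r).FG :=
  Submodule.fg_span (Set.finite_range _)

lemma one_mem_O0 {p q : ℕ} {r : ℤ} : (1 : Bq p q) ∈ O0 p q r := by
  rw [← fb_zero (r := r)]; exact fb_mem 0

lemma mul_mem_O0 {p q : ℕ} {r s h : ℤ} (hs : (q : ℤ) = 4 * s - 1) (hh : (p : ℤ) = q * h - r ^ 2)
    {z w : Bq p q} (hz : z ∈ O0 p q r) (hw : w ∈ O0 p q r) : z * w ∈ O0 p q r := by
  rw [mem_O0] at *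
  obtain ⟨a, rfl⟩ := hz
  obtain ⟨b, rfl⟩ := hw
  have hs' : (q : ℚ) = 4 * s - 1 := by exact_mod_cast hs
  have hh' : (p : ℚ) = q * h - r ^ 2 := by exact_mod_cast hh
  have hne : (4 * s - 1 : ℚ) ≠ 0 := by
    have : (4 * s - 1 : ℤ) ≠ 0 := by omega
    exact_mod_cast this
  refine ⟨![a 0*b 0 + h*s*a 2*b 2 - s*a 1*b 1 - r*a 1*b 3 - 4*h*s^2*a 2*b 2 - 2*h*s*a 2*b 3 + h*a 2*b 3
      - 2*h*s*a 3*b 2 - h*a 3*b 3 + r^2*s*a 2*b 2 + r^2*a 2*b 3 - r*s*a 1*b 2 + r*s*a 2*b 1,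
    a 0*b 1 + a 1*b 1 + a 1*b 0 + h*a 3*b 2 - h*a 2*b 3 + 2*r*s*a 1*b 2 + r*a 1*b 3 + r^2*a 3*b 2
      - 2*r*s*a 2*b 1 - r^2*a 2*b 3 - r*a 3*b 1,
    a 0*b 2 + a 2*b 0 + a 2*b 1 + 2*s*a 1*b 2 + a 1*b 3 + r*a 3*b 2 - 2*s*a 2*b 1 - r*a 2*b 3 - a 3*b 1,
    a 0*b 3 + a 1*b 3 - s*a 2*b 1 + a 3*b 0 + s*a 1*b 2 - 4*s^2*a 1*b 2 - 2*s*a 1*b 3 - 2*r*s*a 3*b 2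
      + 4*s^2*a 2*b 1 + 2*r*s*a 2*b 3 + 2*s*a 3*b 1], ?_⟩
  ext
  · simp [el]
    rw [hh', hs']; field_simp; ring
  · simp [el]
    rw [hs']; field_simp; ring
  · simp [el]
    rw [hh', hs']; field_simp; ring
  · simp [el]
    rw [hs']; field_simp; ring

lemma gram_fb {p q : ℕ} {r s h : ℤ} (hs : (q : ℤ) = 4 * s - 1) (hh : (p : ℤ) = q * h - r ^ 2) :
    (Matrix.of fun i j => Trq (fb p q r i * star (fb p q r j))).det = p ^ 2 := by
  have hs' : (q : ℚ) = 4 * s - 1 := by exact_mod_cast hs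
  have hh' : (p : ℚ) = q * h - r ^ 2 := by exact_mod_cast hh
  have hne : (4 * s - 1 : ℚ) ≠ 0 := by
    have : (4 * s - 1 : ℤ) ≠ 0 := by omega
    exact_mod_cast this
  simp only [Trq_bil]
  have : (Matrix.of fun i j => 2 * ((fb p q r i).re * (fb p q r j).re + p * ((fb p q r i).imI * (fb p q r j).imI) + q * ((fb p q r i).imJ * (fb p q r j).imJ)
      + p * q * ((fb p q r i).imK * (fb p q r j).imK))) = !![(2 : ℚ), 1, 0, 0; 1, 2 * (s : ℚ), 0, (r : ℚ); 0, 0, 2 * (s : ℚ) * p, (p : ℚ); 0, (r : ℚ), (p : ℚ), 2 * (h : ℚ)] := by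
    ext i j
    fin_cases i <;> fin_cases j <;> simp [fb, el, Pi.single_apply] <;> (try rw [hh']) <;> (try rw [hs']) <;> field_simp <;> ring
  rw [this]
  simp [Matrix.det_succ_row_zero, Fin.sum_univ_succ, Fin.succAbove]
  rw [hh', hs']
  ring

lemma mem_O0_of_dual {p q : ℕ} [hp : Fact p.Prime] (hodd : Odd p) (hq : q.Prime) (hq8 : q % 8 = 3)
    {r s h : ℤ} (hs : (q : ℤ) = 4 * s - 1) (hh : (p : ℤ) = q * h - r ^ 2) (z : Bq p q)
    (hN : ∃ n : ℤ, Nrq z = n) (hT : ∀ i, ∃ n : ℤ, Trq (z * star (fb p q r i)) = n) :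
    z ∈ O0 p q r := by
  have hs' : (q : ℚ) = 4 * s - 1 := by exact_mod_cast hs
  have hh' : (p : ℚ) = q * h - r ^ 2 := by exact_mod_cast hh
  have hq0 : (q : ℚ) ≠ 0 := by exact_mod_cast hq.ne_zero
  have hloc := local_main hodd hq hq8 ⟨r, ⟨h, by rw [hh]; ring⟩⟩ z
    (by obtain ⟨n, hn⟩ := hN; rw [hn]; exact int_mem_pInt n)
    (by
      obtain ⟨n, hn⟩ := hT 0
      rw [fb_zero, star_one, mul_one] at hn
      rw [hn]; exact int_mem_pInt n)
  obtain ⟨l0, l1, l2, l3⟩ := hloc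
  obtain ⟨t0, h0⟩ := hT 0
  obtain ⟨t1, h1⟩ := hT 1
  obtain ⟨t2, h2⟩ := hT 2
  obtain ⟨t3, h3⟩ := hT 3
  have hri := int_mem_pInt (p := p) r
  have hqi := int_mem_pInt (p := p) q
  have h2i := int_mem_pInt (p := p) 2
  push_cast at hqi h2i
  -- r * imK is p-integral
  have lr : r * z.imK ∈ pInt p := by
    by_cases hpq : p = q
    · have hqr : (q : ℤ) ∣ r := by
        apply (Nat.prime_iff_prime_int.1 hq).dvd_of_dvd_pow (n := 2)
        exact ⟨h - 1, by rw [hpq] at hh; linear_combination hh⟩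
      obtain ⟨c, rfl⟩ := hqr
      have := mul_mem (int_mem_pInt (p := p) c) l3
      convert this using 1
      push_cast; ring
    · have hqp : ¬ (p : ℤ) ∣ q := by
        intro h
        exact hpq ((Nat.prime_dvd_prime_iff_eq hp.out hq).1 (by exact_mod_cast h))
      exact mul_mem hri (pInt_of_mul hqp (by exact_mod_cast l3))
  obtain ⟨m, hm⟩ : ∃ m : Fin 4 → ℚ, m = ![z.re - z.imJ + r * (z.imK - z.imI),
    2 * z.imJ - 2 * r * (z.imK - z.imI), 2 * z.imI, q * (z.imK - z.imI)] := ⟨_, rfl⟩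
  have hz : z = el p q r m := by
    ext <;> simp [hm, el] <;> field_simp <;> ring
  have k2 : m 2 ∈ pInt p := by
    simp only [hm]; exact mul_mem h2i l1
  have k3 : m 3 ∈ pInt p := by
    simp only [hm]
    convert sub_mem l3 (mul_mem hqi l1) using 1
    simp; ring
  have kk : r * (z.imK - z.imI) ∈ pInt p := by
    convert sub_mem lr (mul_mem hri l1) using 1
    ring
  have k1 : m 1 ∈ pInt p := by
    simp only [hm]
    convert sub_mem (mul_mem h2i l2) (mul_mem h2i kk) using 1
    simp; ring
  have k0 : m 0 ∈ pInt p := by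
    simp only [hm]
    exact add_mem (sub_mem l0 l2) kk
  clear hm
  subst hz
  have e0 : 2 * m 0 + m 1 = t0 := by
    rw [← h0, Trq_bil]; simp [fb, el]; field_simp
  have e1 : m 0 + 2 * s * m 1 + r * m 3 = t1 := by
    rw [← h1, Trq_bil]; simp [fb, el]; field_simp; rw [hs']; ring
  have e2 : p * (2 * s * m 2 + m 3) = t2 := by
    rw [← h2, Trq_bil]; simp [fb, el]; field_simp; rw [hs']; ring
  have e3 : r * m 1 + p * m 2 + 2 * h * m 3 = t3 := by
    rw [← h3, Trq_bil]; simp [fb, el]; field_simp; rw [hh']; ring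
  have i2 : ∃ n : ℤ, m 2 = n := by
    apply int_of_pInt k2
    refine ⟨2 * t2 - q * t3 + r * (2 * t1 - t0), ?_⟩
    push_cast
    rw [← e0, ← e1, ← e2, ← e3, hh', hs']; ring
  obtain ⟨n2, i2⟩ := i2
  have i3 : ∃ n : ℤ, m 3 = n := by
    apply int_of_pInt k3
    refine ⟨t2 - 2 * s * p * n2, ?_⟩
    push_cast
    rw [← e2, ← i2]; ring
  obtain ⟨n3, i3⟩ := i3
  have i1 : ∃ n : ℤ, m 1 = n := by
    apply int_of_pInt k1
    refine ⟨h * (2 * t1 - t0 - 2 * r * n3) - r * (t3 - p * n2 - 2 * h * n3), ?_⟩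
    push_cast
    rw [← e0, ← e1, ← e3, ← i2, ← i3, hh', hs']; ring
  obtain ⟨n1, i1⟩ := i1
  rw [mem_O0]
  refine ⟨![t1 - 2 * s * n1 - r * n3, n1, n2, n3], ?_⟩
  congr 1
  ext i
  fin_cases i
  · simp; rw [← e1, i1, i3]; ring
  · simpa using i1
  · simpa using i2
  · simpa using i3

end GrossPaper
namespace GrossPaper

lemma exists_content {p q : ℕ} (I : Submodule ℤ (Bq p q)) (hI : I.FG) (h1 : (1 : Bq p q) ∈ I) :
    ∃ (n : ℚ) (k : Bq p q → ℤ), 0 < n ∧ (∀ a ∈ I, Nrq a = n * k a) ∧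
      Ideal.span (k '' (I : Set (Bq p q))) = ⊤ := by
  obtain ⟨N, hN, h⟩ := fg_den I hI
  choose! l hl using h
  have hN' : (N : ℚ) ≠ 0 := by exact_mod_cast hN.ne'
  obtain ⟨g, hg⟩ := (inferInstance : (Ideal.span (l '' (I : Set (Bq p q)))).IsPrincipal)
  rw [← Ideal.span] at hg
  have hdiv : ∀ a ∈ I, g ∣ l a := by
    intro a ha
    rw [← Ideal.mem_span_singleton, ← hg]
    exact Ideal.subset_span ⟨a, ha, rfl⟩
  have hg0 : g ≠ 0 := by
    rintro rfl
    have := hdiv 1 h1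
    have h2 := hl 1 h1
    rw [zero_dvd_iff] at this
    rw [this, Nrq_one] at h2
    simp at h2
    omega
  wlog hgpos : 0 < g generalizing g
  · exact this (-g) (by rw [hg, Ideal.span_singleton_neg]) (fun a ha => (neg_dvd).2 (hdiv a ha)) (by simpa using hg0) (by omega)
  choose! k hk using hdiv
  refine ⟨g / N, k, by positivity, ?_, ?_⟩
  · intro a ha
    have := hl a ha
    rw [hk a ha] at this
    push_cast at this
    field_simp
    linarith
  · rw [Ideal.eq_top_iff_one]
    have h3 : Ideal.span {g} * Ideal.span (k '' (I : Set (Bq p q))) = Ideal.span {g} := by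
      conv_rhs => rw [← hg]
      rw [Ideal.span_mul_span']
      congr 1
      ext t
      simp only [Set.singleton_mul, Set.mem_image]
      constructor
      · rintro ⟨_, ⟨a, ha, rfl⟩, rfl⟩
        exact ⟨a, ha, hk a ha⟩
      · rintro ⟨a, ha, rfl⟩
        exact ⟨_, ⟨a, ha, rfl⟩, (hk a ha).symm⟩
    have h4 : g ∈ Ideal.span {g} * Ideal.span (k '' (I : Set (Bq p q))) := by
      rw [h3]; exact Ideal.mem_span_singleton_self g
    rw [Ideal.mem_span_singleton_mul] at h4
    obtain ⟨z, hz, e⟩ := h4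
    have : z = 1 := by
      apply mul_left_cancel₀ hg0; rw [e, mul_one]
    rwa [← this]

lemma Trq_smul {p q : ℕ} (c : ℚ) (u : Bq p q) : Trq (c • u) = c * Trq u := by
  simp [Trq]; ring

/-- right order of a lattice -/
def rightOrder {p q : ℕ} (I : Submodule ℤ (Bq p q)) : Subring (Bq p q) where
  carrier := {z | ∀ c ∈ I, c * z ∈ I}
  mul_mem' {a b} ha hb c hc := by rw [← mul_assoc]; exact hb _ (ha _ hc)
  one_mem' c hc := by rwa [mul_one]
  add_mem' {a b} ha hb c hc := by rw [mul_add]; exact add_mem (ha _ hc) (hb _ hc)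
  zero_mem' c hc := by rw [mul_zero]; exact zero_mem _
  neg_mem' {a} ha c hc := by rw [mul_neg]; exact neg_mem (ha _ hc)

lemma disc_dvd {p q : ℕ} [hp : Fact p.Prime] (hodd : Odd p) (hq : q.Prime) (hq8 : q % 8 = 3)
    (hqr : ∃ r : ℤ, (q : ℤ) ∣ r ^ 2 + p) (O : Subring (Bq p q)) (hO : IsMaximalOrder O)
    (e : Fin 4 → Bq p q) (he : ∀ i, e i ∈ O)
    (hgen : ∀ w ∈ O, ∃ c : Fin 4 → ℤ, w = ∑ i, (c i : ℚ) • e i) :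
    ∃ d : ℤ, (Matrix.of fun i j => Trq (e i * star (e j))).det = d ∧ d ∣ (p : ℤ) ^ 2 := by
  obtain ⟨r, h, hrh⟩ := hqr
  have hh : (p : ℤ) = q * h - r ^ 2 := by linarith
  obtain ⟨s, hs⟩ : ∃ s : ℤ, (q : ℤ) = 4 * s - 1 := ⟨(q + 1) / 4, by omega⟩
  -- the connecting ideal
  obtain ⟨I, hI⟩ : ∃ I, I = O0 p q r * subm O := ⟨_, rfl⟩
  have hIfg : I.FG := by rw [hI]; exact O0_fg.mul (subm_fg hO.1)
  have h1I : (1 : Bq p q) ∈ I := by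
    rw [hI]
    have := Submodule.mul_mem_mul (one_mem_O0 (p := p) (q := q) (r := r)) (mem_subm.2 (one_mem O))
    simpa using this
  have hleft : ∀ f ∈ O0 p q r, ∀ a ∈ I, f * a ∈ I := by
    intro f hf a ha
    have hle : O0 p q r * O0 p q r ≤ O0 p q r := Submodule.mul_le.2 fun u hu v hv => mul_mem_O0 hs hh hu hv
    have h2 := Submodule.mul_mem_mul hf ha
    rw [hI, ← mul_assoc] at h2
    rw [hI]
    exact mul_le_mul' hle le_rfl h2
  have hright : ∀ a ∈ I, ∀ w ∈ O, a * w ∈ I := by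
    intro a ha w hw
    have hle : subm O * subm O ≤ subm O := Submodule.mul_le.2 fun u hu v hv => mem_subm.2 (mul_mem (mem_subm.1 hu) (mem_subm.1 hv))
    have h2 := Submodule.mul_mem_mul ha (mem_subm.2 hw)
    rw [hI, mul_assoc] at h2
    rw [hI]
    exact mul_le_mul' le_rfl hle h2
  obtain ⟨n, k, hn, hk, hktop⟩ := exists_content I hIfg h1I
  -- traces
  have hTr : ∀ a ∈ I, ∀ b ∈ I, ∃ t : ℤ, Trq (a * star b) = n * t := by
    intro a ha b hb
    refine ⟨k (a + b) - k a - k b, ?_⟩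
    have h3 := Nrq_add a b
    rw [hk _ ha, hk _ hb, hk _ (add_mem ha hb)] at h3
    push_cast
    linarith
  have claim1 : ∀ a ∈ I, ∀ b ∈ I, n⁻¹ • (a * star b) ∈ O0 p q r := by
    intro a ha b hb
    apply mem_O0_of_dual hodd hq hq8 hs hh
    · refine ⟨k a * k b, ?_⟩
      rw [Nrq_smul, Nrq_mul, Nrq_star, hk a ha, hk b hb]
      push_cast
      field_simp
    · intro i
      obtain ⟨t, ht⟩ := hTr a ha _ (hleft _ (fb_mem i) b hb)
      refine ⟨t, ?_⟩
      rw [smul_mul_assoc, mul_assoc, ← star_mul, Trq_smul, ht]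
      field_simp
  have hR : rightOrder I = O := by
    apply hO.2
    · apply isOrder_of_fg
      · have hle : subm (rightOrder I) ≤ I := by
          intro z hz
          have := hz 1 h1I
          rwa [one_mul] at this
        have : IsNoetherian ℤ I := isNoetherian_of_fg_of_noetherian I hIfg
        exact Submodule.FG.of_le hIfg hle
      · rw [eq_top_iff, ← hO.1.2]
        apply Submodule.span_mono
        intro w hw c hc
        exact hright c hc w hw
    · intro w hw c hc
      exact hright c hc w hw
  have claim2 : ∀ a ∈ I, ∀ b ∈ I, n⁻¹ • (star a * b) ∈ O := by
    intro a ha b hb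
    rw [← hR]
    intro c hc
    have := hleft _ (claim1 c hc a ha) b hb
    rw [smul_mul_assoc, mul_assoc] at this
    rw [mul_smul_comm]
    exact this
  -- the discriminant is an integer
  have hint : ∀ i j, ∃ t : ℤ, Trq (e i * star (e j)) = t := fun i j => order_bil hO.1 (he i) (he j)
  choose G hG using hint
  have hdet : (Matrix.of fun i j => Trq (e i * star (e j))).det = ((Matrix.of G).det : ℤ) := by
    have : (Matrix.of fun i j => Trq (e i * star (e j))) = (Int.castRingHom ℚ).mapMatrix (Matrix.of G) := by
      ext i j; simp [hG]
    rw [this, ← RingHom.map_det]; simp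
  refine ⟨_, hdet, ?_⟩
  have key : ∀ a ∈ I, (Matrix.of G).det ∣ (p : ℤ) ^ 2 * (k a) ^ 8 := by
    intro a ha
    have h5 : ∀ i, ∃ c : Fin 4 → ℤ, n⁻¹ • (star a * (fb p q r i * a)) = ∑ j, (c j : ℚ) • e j :=
      fun i => hgen _ (claim2 a ha _ (hleft _ (fb_mem i) a ha))
    choose c hc using h5
    refine ⟨(Matrix.of c).det ^ 2, ?_⟩
    have hgram : (k a : ℚ) ^ 2 • (Matrix.of fun i j => Trq (fb p q r i * star (fb p q r j))) =
        ((Int.castRingHom ℚ).mapMatrix (Matrix.of c)) * (Matrix.of fun i j => Trq (e i * star (e j))) *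
          ((Int.castRingHom ℚ).mapMatrix (Matrix.of c)).transpose := by
      ext i j
      have h6 : Trq ((n⁻¹ • (star a * (fb p q r i * a))) * star (n⁻¹ • (star a * (fb p q r j * a)))) =
          (k a : ℚ) ^ 2 * Trq (fb p q r i * star (fb p q r j)) := by
        have h7 : ∀ u v : Bq p q, Trq ((star a * (u * a)) * star (star a * (v * a))) =
            Nrq a ^ 2 * Trq (u * star v) := by
          intro u v
          rw [Trq_bil, Trq_bil, Nrq_eq]
          simp
          ring
        rw [star_smul, smul_mul_smul_comm, Trq_smul, h7, hk a ha]
        simp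
        field_simp
      rw [hc, hc] at h6
      simp only [Matrix.smul_apply, Matrix.of_apply, smul_eq_mul]
      rw [← h6]
      simp only [Trq_bil, Matrix.mul_apply, Fin.sum_univ_four]
      simp
      ring
    have h8 := congrArg Matrix.det hgram
    rw [Matrix.det_smul, Matrix.det_mul, Matrix.det_mul, Matrix.det_transpose, gram_fb hs hh, hdet,
      ← RingHom.map_det] at h8
    have h9 : ((p : ℤ) ^ 2 * (k a) ^ 8 : ℚ) = (((Matrix.of G).det * (Matrix.of c).det ^ 2 : ℤ) : ℚ) := by
      simp only [Fintype.card_fin, eq_intCast] at h8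
      simp only [Int.cast_mul, Int.cast_pow, Int.cast_natCast]
      linear_combination h8
    exact_mod_cast h9
  have hpow := Ideal.span_pow_eq_top _ hktop 8
  have h10 : (1 : ℤ) ∈ Ideal.span ((fun x => x ^ 8) '' (k '' (I : Set (Bq p q)))) := by
    rw [hpow]; trivial
  have : ∀ t ∈ Ideal.span ((fun x => x ^ 8) '' (k '' (I : Set (Bq p q)))), (Matrix.of G).det ∣ (p : ℤ) ^ 2 * t := by
    intro t ht
    induction ht using Submodule.span_induction with
    | mem x hx =>
      obtain ⟨_, ⟨a, ha, rfl⟩, rfl⟩ := hx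
      exact key a ha
    | zero => simp
    | add x y _ _ hx hy => rw [mul_add]; exact dvd_add hx hy
    | smul c x _ hx =>
      rw [smul_eq_mul, mul_left_comm]
      exact dvd_mul_of_dvd_right hx c
  simpa using this 1 h10

end GrossPaper
namespace GrossPaper

lemma gauss_pos (D E F a b c : ℚ) (hD : 0 ≤ D) (hDE : D ≤ E) (hEF : E ≤ F) (ha : 0 ≤ a) (hb : 0 ≤ b)
    (hc : 0 ≤ c) (ha' : 2 * a ≤ E) (hb' : 2 * b ≤ D) (hc' : 2 * c ≤ D) :
    0 ≤ D * E * F + 4 * a * b * c - 2 * (D * a ^ 2 + E * b ^ 2 + F * c ^ 2) := by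
  have hE : 0 ≤ E := hD.trans hDE
  have s1 : 0 ≤ (F - E) * (D * E - 2 * c ^ 2) := by
    apply mul_nonneg (by linarith)
    nlinarith
  have s2 : 0 ≤ D * a * (E - 2 * a) := by
    apply mul_nonneg (by positivity) (by linarith)
  have bb : b ^ 2 ≤ D ^ 2 / 4 := by nlinarith
  have cc : c ^ 2 ≤ D ^ 2 / 4 := by nlinarith
  have bc : b ^ 2 - b * c + c ^ 2 ≤ D ^ 2 / 4 := by
    rcases le_total b c with h | h <;> nlinarith
  -- (E - 2a) * [E(D E - 2(b²+c²))] + 2a * [E (D E / 2 + 2 b c - 2b² - 2c²)] ≥ 0, divided by E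
  have s3 : 0 ≤ (E - 2 * a) * (D * E - 2 * (b ^ 2 + c ^ 2)) := by
    apply mul_nonneg (by linarith)
    nlinarith
  have s4 : 0 ≤ 2 * a * (D * E / 2 + 2 * b * c - 2 * b ^ 2 - 2 * c ^ 2) := by
    apply mul_nonneg (by linarith)
    nlinarith
  nlinarith

lemma gauss_neg (D E F a b c : ℚ) (hD : 0 ≤ D) (hDE : D ≤ E) (hEF : E ≤ F) (ha : 0 ≤ a) (hb : 0 ≤ b)
    (hc : 0 ≤ c) (ha' : 2 * a ≤ E) (hb' : 2 * b ≤ D) (hc' : 2 * c ≤ D)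
    (habc : 2 * (a + b + c) ≤ D + E) :
    0 ≤ D * E * F - 4 * a * b * c - 2 * (D * a ^ 2 + E * b ^ 2 + F * c ^ 2) := by
  have hE : 0 ≤ E := hD.trans hDE
  have s1 : 0 ≤ (F - E) * (D * E - 2 * c ^ 2) := by
    apply mul_nonneg (by linarith)
    nlinarith
  suffices h : 0 ≤ D * E ^ 2 - 4 * a * (b * c) - 2 * D * a ^ 2 - 2 * E * (b ^ 2 + c ^ 2) by nlinarith
  have hbc : 0 ≤ b * c := mul_nonneg hb hc
  have mono : ∀ a0, a ≤ a0 → 4 * a * (b * c) + 2 * D * a ^ 2 ≤ 4 * a0 * (b * c) + 2 * D * a0 ^ 2 := by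
    intro a0 h
    have h1 : a * (b * c) ≤ a0 * (b * c) := mul_le_mul_of_nonneg_right h hbc
    have h2 : a ^ 2 ≤ a0 ^ 2 := pow_le_pow_left₀ ha h 2
    have h3 : D * a ^ 2 ≤ D * a0 ^ 2 := mul_le_mul_of_nonneg_left h2 hD
    linarith
  rcases le_total (b + c) (D / 2) with hσ | hσ
  · have h1 := mono (E / 2) (by linarith)
    have h2 : (b + c) ^ 2 ≤ (D / 2) ^ 2 := pow_le_pow_left₀ (by linarith) hσ 2
    have h3 : 0 ≤ E * (D * E / 2 - 2 * (b ^ 2 + b * c + c ^ 2)) := by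
      apply mul_nonneg hE
      nlinarith
    nlinarith
  · obtain ⟨τ, hτ⟩ : ∃ τ, τ = b + c - D / 2 := ⟨_, rfl⟩
    have h1 := mono (E / 2 - τ) (by linarith)
    have h2 : D / 2 * τ ≤ b * c := by
      have := mul_nonneg (sub_nonneg.2 hb') (sub_nonneg.2 hc')
      subst hτ
      nlinarith
    have h3 : 0 ≤ τ := by linarith
    have h4 : 0 ≤ D / 2 - τ := by linarith
    have h5 : 0 ≤ (b * c - D / 2 * τ) * (E / 2 + τ) := mul_nonneg (by linarith) (by linarith)
    have h6 : 0 ≤ E * τ * (D / 2 - τ) := by positivity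
    have h7 : 0 ≤ D * E * (E - D) := mul_nonneg (by positivity) (by linarith)
    have h8 : b ^ 2 + c ^ 2 = (τ + D / 2) ^ 2 - 2 * (b * c) := by subst hτ; ring
    rw [h8]
    nlinarith

lemma gauss (D E F a b c : ℚ) (hD : 0 ≤ D) (hDE : D ≤ E) (hEF : E ≤ F)
    (ha : 2 * |a| ≤ E) (hb : 2 * |b| ≤ D) (hc : 2 * |c| ≤ D)
    (h : ∀ ε δ : ℚ, ε ^ 2 = 1 → δ ^ 2 = 1 → 0 ≤ D + E + 2 * (ε * δ * c + ε * b + δ * a)) :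
    D * E * F ≤ 2 * (D * E * F + 2 * a * b * c - D * a ^ 2 - E * b ^ 2 - F * c ^ 2) := by
  have h1 := h 1 1 (by norm_num) (by norm_num)
  have h2 := h 1 (-1) (by norm_num) (by norm_num)
  have h3 := h (-1) 1 (by norm_num) (by norm_num)
  have h4 := h (-1) (-1) (by norm_num) (by norm_num)
  rcases le_total 0 a with sa | sa <;> rcases le_total 0 b with sb | sb <;>
    rcases le_total 0 c with sc | sc <;>
    simp only [abs_of_nonneg, abs_of_nonpos, sa, sb, sc] at ha hb hc
  · have := gauss_pos D E F a b c hD hDE hEF (by linarith) (by linarith) (by linarith) ha hb hc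
    linarith
  · have := gauss_neg D E F a b (-c) hD hDE hEF (by linarith) (by linarith) (by linarith) ha hb hc (by linarith)
    linarith
  · have := gauss_neg D E F a (-b) c hD hDE hEF (by linarith) (by linarith) (by linarith) ha hb hc (by linarith)
    linarith
  · have := gauss_pos D E F a (-b) (-c) hD hDE hEF (by linarith) (by linarith) (by linarith) ha hb hc
    linarith
  · have := gauss_neg D E F (-a) b c hD hDE hEF (by linarith) (by linarith) (by linarith) ha hb hc (by linarith)
    linarith
  · have := gauss_pos D E F (-a) b (-c) hD hDE hEF (by linarith) (by linarith) (by linarith) ha hb hc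
    linarith
  · have := gauss_pos D E F (-a) (-b) c hD hDE hEF (by linarith) (by linarith) (by linarith) ha hb hc
    linarith
  · have := gauss_neg D E F (-a) (-b) (-c) hD hDE hEF (by linarith) (by linarith) (by linarith) ha hb hc (by linarith)
    linarith

/-- Gross lattice as a submodule-like set -/
lemma gross_re {p q : ℕ} {O : Subring (Bq p q)} {t : Bq p q} (h : t ∈ GrossLat O) : t.re = 0 := by
  obtain ⟨w, -, rfl⟩ := h
  have h1 : ∀ r : ℚ, (algebraMap ℚ (Bq p q) r).re = r := fun r => rfl
  rw [two_mul, QuaternionAlgebra.re_sub, QuaternionAlgebra.re_add, h1, Trq]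
  ring

lemma gross_smul {p q : ℕ} {O : Subring (Bq p q)} {t : Bq p q} (h : t ∈ GrossLat O) (n : ℤ) :
    (n : ℚ) • t ∈ GrossLat O := by
  obtain ⟨w, hw, rfl⟩ := h
  refine ⟨n • w, zsmul_mem hw n, ?_⟩
  ext <;> simp [Trq] <;> ring

lemma gross_add {p q : ℕ} {O : Subring (Bq p q)} {t u : Bq p q} (h : t ∈ GrossLat O)
    (h' : u ∈ GrossLat O) : t + u ∈ GrossLat O := by
  obtain ⟨w, hw, rfl⟩ := h
  obtain ⟨v, hv, rfl⟩ := h'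
  refine ⟨w + v, add_mem hw hv, ?_⟩
  ext <;> simp [Trq] <;> ring

lemma gross_comb {p q : ℕ} {O : Subring (Bq p q)} {x y z : Bq p q} (hx : x ∈ GrossLat O)
    (hy : y ∈ GrossLat O) (hz : z ∈ GrossLat O) (a b c : ℤ) :
    (a : ℚ) • x + (b : ℚ) • y + (c : ℚ) • z ∈ GrossLat O :=
  gross_add (gross_add (gross_smul hx a) (gross_smul hy b)) (gross_smul hz c)

lemma Nrq_comb {p q : ℕ} (x y z : Bq p q) (u v w : ℚ) :
    Nrq (u • x + v • y + w • z) = u ^ 2 * Nrq x + v ^ 2 * Nrq y + w ^ 2 * Nrq z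
      + u * v * Trq (x * star y) + u * w * Trq (x * star z) + v * w * Trq (y * star z) := by
  simp only [Nrq_eq, Trq_bil]
  simp
  ring

/-- abstract reducedness -/
structure Red {p q : ℕ} (T : Set (Bq p q)) (x y z : Bq p q) : Prop where
  hx : x ∈ T
  hy : y ∈ T
  hz : z ∈ T
  li : LinearIndependent ℚ ![x, y]
  lz : z ∉ Submodule.span ℚ ({x, y} : Set (Bq p q))
  m1 : ∀ t ∈ T, t ≠ 0 → Nrq x ≤ Nrq t
  m2 : ∀ t ∈ T, (∀ c : ℚ, t ≠ c • x) → Nrq y ≤ Nrq t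
  m3 : ∀ t ∈ T, t ∉ Submodule.span ℚ ({x, y} : Set (Bq p q)) → Nrq z ≤ Nrq t

lemma li_xyz {p q : ℕ} {T : Set (Bq p q)} {x y z : Bq p q} (h : Red T x y z) (a b c : ℚ)
    (h0 : a • x + b • y + c • z = 0) : a = 0 ∧ b = 0 ∧ c = 0 := by
  have hc : c = 0 := by
    by_contra hc
    apply h.lz
    rw [Submodule.mem_span_pair]
    refine ⟨-(c⁻¹ * a), -(c⁻¹ * b), ?_⟩
    have : z = c⁻¹ • (c • z) := by rw [smul_smul, inv_mul_cancel₀ hc, one_smul]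
    have h2 : c • z = -(a • x + b • y) := by
      rw [← sub_eq_zero, ← h0]; abel
    rw [this, h2]
    module
  subst hc
  have := (LinearIndependent.pair_iff.1 h.li) a b (by simpa using h0)
  exact ⟨this.1, this.2, rfl⟩

lemma not_span {p q : ℕ} {T : Set (Bq p q)} {x y z : Bq p q} (h : Red T x y z) (a b c : ℚ)
    (hc : c ≠ 0) : a • x + b • y + c • z ∉ Submodule.span ℚ ({x, y} : Set (Bq p q)) := by
  intro hm
  rw [Submodule.mem_span_pair] at hm
  obtain ⟨u, v, huv⟩ := hm
  have := li_xyz h (a - u) (b - v) c (by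
    have : (a - u) • x + (b - v) • y + c • z = a • x + b • y + c • z - (u • x + v • y) := by module
    rw [this, huv, sub_self])
  exact hc this.2.2

lemma not_mult {p q : ℕ} {T : Set (Bq p q)} {x y z : Bq p q} (h : Red T x y z) (a b : ℚ)
    (hb : b ≠ 0) : ∀ c : ℚ, a • x + b • y + (0 : ℚ) • z ≠ c • x := by
  intro c hc
  have := li_xyz h (a - c) b 0 (by
    have : (a - c) • x + b • y + (0 : ℚ) • z = a • x + b • y + (0 : ℚ) • z - c • x := by module
    rw [this, hc, sub_self])
  exact hb this.2.1

lemma not_zero {p q : ℕ} {T : Set (Bq p q)} {x y z : Bq p q} (h : Red T x y z) (a b c : ℚ)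
    (hn : a ≠ 0) : a • x + b • y + c • z ≠ 0 := fun h0 => hn (li_xyz h a b c h0).1

lemma red_le {p q : ℕ} {T : Set (Bq p q)} {x y z : Bq p q} (h : Red T x y z) :
    Nrq x ≤ Nrq y ∧ Nrq y ≤ Nrq z := by
  constructor
  · apply h.m1 _ h.hy
    rintro rfl
    simpa using (LinearIndependent.pair_iff.1 h.li) 0 1 (by simp)
  · apply h.m2 _ h.hz
    intro c hc
    apply h.lz
    rw [hc]
    exact Submodule.smul_mem _ _ (Submodule.subset_span (by simp))

lemma red_pos {p q : ℕ} (hp : 0 < p) (hq : 0 < q) {T : Set (Bq p q)} {x y z : Bq p q}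
    (h : Red T x y z) : 0 < Nrq x := by
  apply lt_of_le_of_ne (Nrq_nonneg x)
  intro h0
  have := Nrq_eq_zero hp hq x h0.symm
  subst this
  simpa using (LinearIndependent.pair_iff.1 h.li) 1 0 (by simp)

lemma red_xy {p q : ℕ} {O : Subring (Bq p q)} {x y z : Bq p q} (h : Red (GrossLat O) x y z) :
    |Trq (x * star y)| ≤ Nrq x := by
  have key : ∀ e : ℤ, e ^ 2 = 1 → 0 ≤ Nrq x + e * Trq (x * star y) := by
    intro e he
    have he' : (e : ℚ) ^ 2 = 1 := by exact_mod_cast he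
    have := h.m2 _ (gross_comb h.hx h.hy h.hz e 1 0) (by
      have := not_mult h e 1 one_ne_zero
      simpa using this)
    rw [Nrq_comb, he'] at this
    push_cast at this
    linarith
  have h1 := key 1 (by norm_num)
  have h2 := key (-1) (by norm_num)
  push_cast at h1 h2
  rw [abs_le]; constructor <;> linarith

lemma red_gauss {p q : ℕ} (hp : 0 < p) (hq : 0 < q) {O : Subring (Bq p q)} {x y z : Bq p q}
    (h : Red (GrossLat O) x y z) (a b c : ℚ)
    (ha : Trq (y * star z) = 2 * a) (hb : Trq (x * star z) = 2 * b) (hc : Trq (x * star y) = 2 * c) :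
    Nrq x * Nrq y * Nrq z ≤ 2 * (Nrq x * Nrq y * Nrq z + 2 * a * b * c - Nrq x * a ^ 2
      - Nrq y * b ^ 2 - Nrq z * c ^ 2) := by
  have key : ∀ e f : ℤ, 0 ≤ e ^ 2 * Nrq x + f ^ 2 * Nrq y + 2 * (e * f * c + e * b + f * a) := by
    intro e f
    have := h.m3 _ (gross_comb h.hx h.hy h.hz e f 1) (by
      have := not_span h e f 1 one_ne_zero
      simpa using this)
    rw [Nrq_comb, ha, hb, hc] at this
    push_cast at this
    linarith
  have hl := red_le h
  have hxy := red_xy h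
  rw [hc, abs_mul, abs_two] at hxy
  apply gauss _ _ _ _ _ _ (Nrq_nonneg x) hl.1 hl.2 ?_ ?_ hxy
  · intro ε δ hε hδ
    have h11 := key 1 1
    have h12 := key 1 (-1)
    have h21 := key (-1) 1
    have h22 := key (-1) (-1)
    push_cast at h11 h12 h21 h22
    rcases sq_eq_one_iff.1 hε with rfl | rfl <;> rcases sq_eq_one_iff.1 hδ with rfl | rfl <;> linarith
  · have h1 := key 0 1
    have h2 := key 0 (-1)
    push_cast at h1 h2
    have : |a| ≤ Nrq y / 2 := abs_le.2 ⟨by linarith, by linarith⟩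
    linarith
  · have h1 := key 1 0
    have h2 := key (-1) 0
    push_cast at h1 h2
    have : |b| ≤ Nrq x / 2 := abs_le.2 ⟨by linarith, by linarith⟩
    linarith

end GrossPaper
namespace GrossPaper

lemma red_of {p q : ℕ} {T : Set (Bq p q)} {D₁ D₂ D₃ : ℝ} {x y z : Bq p q}
    (hm1 : SuccMin T 1 D₁) (hm2 : SuccMin T 2 D₂) (hm3 : SuccMin T 3 D₃)
    (hx : x ∈ T) (hy : y ∈ T) (hz : z ∈ T)
    (hxD : (Nrq x : ℝ) = D₁) (hyD : (Nrq y : ℝ) = D₂) (hzD : (Nrq z : ℝ) = D₃)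
    (hxy : LinearIndependent ℚ ![x, y])
    (hzxy : z ∉ Submodule.span ℚ ({x, y} : Set (Bq p q))) : Red T x y z := by
  have hx0 : x ≠ 0 := by
    rintro rfl
    simpa using (LinearIndependent.pair_iff.1 hxy) 1 0 (by simp)
  have m1 : ∀ t ∈ T, t ≠ 0 → Nrq x ≤ Nrq t := by
    intro t ht h0
    have : D₁ ≤ (Nrq t : ℝ) := hm1.2 ⟨![t], by simpa using ht, by
      apply LinearIndependent.of_subsingleton (0 : Fin 1); simpa using h0, by simp⟩
    rw [← hxD] at this
    exact_mod_cast this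
  have m2 : ∀ t ∈ T, (∀ c : ℚ, t ≠ c • x) → Nrq y ≤ Nrq t := by
    intro t ht h0
    have ht0 : t ≠ 0 := by simpa using h0 0
    have h1 := m1 t ht ht0
    have : D₂ ≤ (Nrq t : ℝ) := hm2.2 ⟨![x, t], by
        intro n; fin_cases n
        · exact hx
        · exact ht, by
        rw [LinearIndependent.pair_iff' hx0]
        intro c hc
        exact h0 c hc.symm, by
        intro n; fin_cases n
        · simpa using h1
        · simp⟩
    rw [← hyD] at this
    exact_mod_cast this
  refine ⟨hx, hy, hz, hxy, hzxy, m1, m2, ?_⟩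
  intro t ht h0
  have hxt : Nrq x ≤ Nrq t := m1 t ht (by rintro rfl; exact h0 (Submodule.zero_mem _))
  have hyt : Nrq y ≤ Nrq t := m2 t ht (by
    rintro c rfl
    exact h0 (Submodule.smul_mem _ _ (Submodule.subset_span (by simp))))
  have : D₃ ≤ (Nrq t : ℝ) := hm3.2 ⟨![x, y, t], by
      intro n; fin_cases n
      · exact hx
      · exact hy
      · exact ht, by
      rw [LinearIndependent.pair_iff] at hxy
      rw [Fintype.linearIndependent_iff]
      intro g hg
      simp only [Fin.sum_univ_three, Matrix.cons_val_zero, Matrix.cons_val_one, Matrix.cons_val] at hg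
      have h2 : g 2 = 0 := by
        by_contra hc
        apply h0
        rw [Submodule.mem_span_pair]
        refine ⟨-((g 2)⁻¹ * g 0), -((g 2)⁻¹ * g 1), ?_⟩
        have e1 : t = (g 2)⁻¹ • (g 2 • t) := by rw [smul_smul, inv_mul_cancel₀ hc, one_smul]
        have e2 : g 2 • t = -(g 0 • x + g 1 • y) := by
          rw [← sub_eq_zero, ← hg]; abel
        rw [e1, e2]
        module
      have h3 := hxy (g 0) (g 1) (by simpa [h2] using hg)
      intro i; fin_cases i
      · exact h3.1
      · exact h3.2
      · exact h2, by
      intro n; fin_cases n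
      · simpa using hxt
      · simpa using hyt
      · simp⟩
  rw [← hzD] at this
  exact_mod_cast this

lemma gen_rat {p q : ℕ} {T : Set (Bq p q)} {x y z : Bq p q} (h : Red T x y z)
    (hT : ∀ t ∈ T, t.re = 0) (w : Bq p q) (hw : w.re = 0) :
    ∃ a b c : ℚ, w = a • x + b • y + c • z := by
  have hli : LinearIndependent ℚ (![1, x, y, z] : Fin 4 → Bq p q) := by
    rw [Fintype.linearIndependent_iff]
    intro g hg
    simp only [Fin.sum_univ_four, Matrix.cons_val_zero, Matrix.cons_val_one, Matrix.cons_val] at hg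
    have h0 : g 0 = 0 := by
      have := congrArg (fun u : Bq p q => u.re) hg
      simpa [hT _ h.hx, hT _ h.hy, hT _ h.hz] using this
    have h3 := li_xyz h (g 1) (g 2) (g 3) (by simpa [h0] using hg)
    intro i; fin_cases i
    · exact h0
    · exact h3.1
    · exact h3.2.1
    · exact h3.2.2
  have hs := hli.span_eq_top_of_card_eq_finrank (by simp [QuaternionAlgebra.finrank_eq_four])
  have hm : w ∈ Submodule.span ℚ (Set.range (![1, x, y, z] : Fin 4 → Bq p q)) := by
    rw [hs]; trivial
  obtain ⟨c, hc⟩ := (Submodule.mem_span_range_iff_exists_fun ℚ).1 hm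
  simp only [Fin.sum_univ_four, Matrix.cons_val_zero, Matrix.cons_val_one, Matrix.cons_val] at hc
  have h0 : c 0 = 0 := by
    have := congrArg (fun u : Bq p q => u.re) hc
    simpa [hT _ h.hx, hT _ h.hy, hT _ h.hz, hw] using this
  refine ⟨c 1, c 2, c 3, ?_⟩
  rw [← hc, h0]; simp

lemma gen_int {p q : ℕ} (hp : 0 < p) (hq : 0 < q) {O : Subring (Bq p q)} {x y z : Bq p q}
    (h : Red (GrossLat O) x y z)
    (w : Bq p q) (hw : w ∈ GrossLat O) :
    ∃ a b c : ℤ, w = (a : ℚ) • x + (b : ℚ) • y + (c : ℚ) • z := by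
  obtain ⟨A, B, C, hABC⟩ := gen_rat h (fun t ht => gross_re ht) w (gross_re hw)
  have hpos := red_pos hp hq h
  obtain ⟨hl1, hl2⟩ := red_le h
  -- translates
  have tr : ∀ l m n : ℤ, (A - l) • x + (B - m) • y + (C - n) • z ∈ GrossLat O := by
    intro l m n
    have := gross_add hw (gross_comb h.hx h.hy h.hz (-l) (-m) (-n))
    rw [hABC] at this
    convert this using 1
    push_cast
    module
  obtain ⟨a, ha⟩ : ∃ a, a = Int.fract A := ⟨_, rfl⟩
  obtain ⟨b, hb⟩ : ∃ b, b = Int.fract B := ⟨_, rfl⟩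
  obtain ⟨c, hc⟩ : ∃ c, c = Int.fract C := ⟨_, rfl⟩
  have ha0 : 0 ≤ a := ha ▸ Int.fract_nonneg A
  have hb0 : 0 ≤ b := hb ▸ Int.fract_nonneg B
  have hc0 : 0 ≤ c := hc ▸ Int.fract_nonneg C
  have ha1 : a < 1 := ha ▸ Int.fract_lt_one A
  have hb1 : b < 1 := hb ▸ Int.fract_lt_one B
  have hc1 : c < 1 := hc ▸ Int.fract_lt_one C
  have tr' : ∀ l m n : ℤ, (a - l) • x + (b - m) • y + (c - n) • z ∈ GrossLat O := by
    intro l m n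
    have := tr (⌊A⌋ + l) (⌊B⌋ + m) (⌊C⌋ + n)
    push_cast at this
    rw [ha, hb, hc, ← Int.self_sub_floor, ← Int.self_sub_floor, ← Int.self_sub_floor]
    have e : ∀ X : ℚ, ∀ l : ℤ, X - (⌊X⌋ : ℚ) - l = X - (⌊X⌋ + l) := by intros; ring
    rw [e, e, e]
    exact this
  have haa : a * (1 - a) ≤ 1 / 4 := by nlinarith [sq_nonneg (2 * a - 1)]
  have hbb : b * (1 - b) ≤ 1 / 4 := by nlinarith [sq_nonneg (2 * b - 1)]
  have hcc : c * (1 - c) ≤ 1 / 4 := by nlinarith [sq_nonneg (2 * c - 1)]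
  have hx0 : a * (1 - a) * Nrq x ≤ 1 / 4 * Nrq x := mul_le_mul_of_nonneg_right haa hpos.le
  have hy0 : b * (1 - b) * Nrq y ≤ 1 / 4 * Nrq y := mul_le_mul_of_nonneg_right hbb (by linarith)
  have hz0 : c * (1 - c) * Nrq z ≤ 1 / 4 * Nrq z := mul_le_mul_of_nonneg_right hcc (by linarith)
  have c0 : c = 0 := by
    by_contra hcne
    have K : ∀ l m n : ℤ, c - n ≠ 0 → Nrq z ≤ (a - l) ^ 2 * Nrq x + (b - m) ^ 2 * Nrq y
        + (c - n) ^ 2 * Nrq z + (a - l) * (b - m) * Trq (x * star y)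
        + (a - l) * (c - n) * Trq (x * star z) + (b - m) * (c - n) * Trq (y * star z) := by
      intro l m n hn
      rw [← Nrq_comb]
      exact h.m3 _ (tr' l m n) (not_span h _ _ _ hn)
    have n0 : c - (0 : ℤ) ≠ 0 := by simpa using hcne
    have n1 : c - (1 : ℤ) ≠ 0 := by push_cast; linarith
    have w1 : 0 ≤ 1 - a := by linarith
    have w2 : 0 ≤ 1 - b := by linarith
    have w3 : 0 ≤ 1 - c := by linarith
    have k1 := mul_le_mul_of_nonneg_left (K 0 0 0 n0) (by positivity : 0 ≤ (1 - a) * (1 - b) * (1 - c))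
    have k2 := mul_le_mul_of_nonneg_left (K 0 0 1 n1) (by positivity : 0 ≤ (1 - a) * (1 - b) * c)
    have k3 := mul_le_mul_of_nonneg_left (K 0 1 0 n0) (by positivity : 0 ≤ (1 - a) * b * (1 - c))
    have k4 := mul_le_mul_of_nonneg_left (K 0 1 1 n1) (by positivity : 0 ≤ (1 - a) * b * c)
    have k5 := mul_le_mul_of_nonneg_left (K 1 0 0 n0) (by positivity : 0 ≤ a * (1 - b) * (1 - c))
    have k6 := mul_le_mul_of_nonneg_left (K 1 0 1 n1) (by positivity : 0 ≤ a * (1 - b) * c)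
    have k7 := mul_le_mul_of_nonneg_left (K 1 1 0 n0) (by positivity : 0 ≤ a * b * (1 - c))
    have k8 := mul_le_mul_of_nonneg_left (K 1 1 1 n1) (by positivity : 0 ≤ a * b * c)
    push_cast at k1 k2 k3 k4 k5 k6 k7 k8
    have : Nrq z ≤ a * (1 - a) * Nrq x + b * (1 - b) * Nrq y + c * (1 - c) * Nrq z := by
      linarith
    linarith
  have b0 : b = 0 := by
    by_contra hbne
    have K : ∀ l m : ℤ, b - m ≠ 0 → Nrq y ≤ (a - l) ^ 2 * Nrq x + (b - m) ^ 2 * Nrq y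
        + (a - l) * (b - m) * Trq (x * star y) := by
      intro l m hm
      have := tr' l m 0
      rw [c0, Int.cast_zero, sub_zero] at this
      have := h.m2 _ this (not_mult h _ _ hm)
      rw [Nrq_comb] at this
      linarith
    have n0 : b - (0 : ℤ) ≠ 0 := by simpa using hbne
    have n1 : b - (1 : ℤ) ≠ 0 := by push_cast; linarith
    have w1 : 0 ≤ 1 - a := by linarith
    have w2 : 0 ≤ 1 - b := by linarith
    have k1 := mul_le_mul_of_nonneg_left (K 0 0 n0) (by positivity : 0 ≤ (1 - a) * (1 - b))
    have k2 := mul_le_mul_of_nonneg_left (K 0 1 n1) (by positivity : 0 ≤ (1 - a) * b)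
    have k3 := mul_le_mul_of_nonneg_left (K 1 0 n0) (by positivity : 0 ≤ a * (1 - b))
    have k4 := mul_le_mul_of_nonneg_left (K 1 1 n1) (by positivity : 0 ≤ a * b)
    push_cast at k1 k2 k3 k4
    have : Nrq y ≤ a * (1 - a) * Nrq x + b * (1 - b) * Nrq y := by
      linarith
    linarith
  have a0 : a = 0 := by
    by_contra hane
    have := tr' 0 0 0
    rw [c0, b0] at this
    have := h.m1 _ this (not_zero h _ _ _ (by simpa using hane))
    rw [Nrq_comb] at this
    push_cast at this
    have hlt : a ^ 2 * Nrq x < 1 * Nrq x := mul_lt_mul_of_pos_right (by nlinarith) hpos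
    linarith
  refine ⟨⌊A⌋, ⌊B⌋, ⌊C⌋, ?_⟩
  rw [hABC]
  have e1 := Int.floor_add_fract A
  have e2 := Int.floor_add_fract B
  have e3 := Int.floor_add_fract C
  rw [← ha, a0, add_zero] at e1
  rw [← hb, b0, add_zero] at e2
  rw [← hc, c0, add_zero] at e3
  rw [e1, e2, e3]

end GrossPaper
namespace GrossPaper

lemma gross_bil {p q : ℕ} (o o' : Bq p q) :
    Trq ((2 * o - algebraMap ℚ (Bq p q) (Trq o)) * star (2 * o' - algebraMap ℚ (Bq p q) (Trq o')))
      = 4 * Trq (o * star o') - 2 * Trq o * Trq o' := by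
  have h1 : ∀ r : ℚ, (algebraMap ℚ (Bq p q) r).re = r := fun r => rfl
  have h2 : ∀ r : ℚ, (algebraMap ℚ (Bq p q) r).imI = 0 := fun r => rfl
  have h3 : ∀ r : ℚ, (algebraMap ℚ (Bq p q) r).imJ = 0 := fun r => rfl
  have h4 : ∀ r : ℚ, (algebraMap ℚ (Bq p q) r).imK = 0 := fun r => rfl
  rw [Trq_bil, Trq_bil, two_mul o, two_mul o']
  simp only [QuaternionAlgebra.re_sub, QuaternionAlgebra.re_add, QuaternionAlgebra.imI_sub,
    QuaternionAlgebra.imI_add, QuaternionAlgebra.imJ_sub, QuaternionAlgebra.imJ_add,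
    QuaternionAlgebra.imK_sub, QuaternionAlgebra.imK_add, h1, h2, h3, h4, Trq]
  ring

lemma Trq_self {p q : ℕ} (o : Bq p q) : Trq (o * star o) = 2 * Nrq o := rfl

lemma gross_nr {p q : ℕ} (o : Bq p q) :
    Nrq (2 * o - algebraMap ℚ (Bq p q) (Trq o)) = 4 * Nrq o - Trq o ^ 2 := by
  have := gross_bil o o
  rw [Trq_self, Trq_self] at this
  linarith

lemma Trq_comm {p q : ℕ} (u v : Bq p q) : Trq (u * star v) = Trq (v * star u) := by
  rw [Trq_bil, Trq_bil]; ring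

lemma Trq_one_left {p q : ℕ} (u : Bq p q) : Trq (1 * star u) = Trq u := by
  rw [one_mul]; simp [Trq]

lemma det4 (A B C a b c t u v : ℚ) :
    (Matrix.of ![![2, t, u, v], ![t, (A + t ^ 2) / 2, (c + t * u) / 2, (b + t * v) / 2],
      ![u, (c + t * u) / 2, (B + u ^ 2) / 2, (a + u * v) / 2],
      ![v, (b + t * v) / 2, (a + u * v) / 2, (C + v ^ 2) / 2]] : Matrix (Fin 4) (Fin 4) ℚ).det
    = (A * B * C + 2 * a * b * c - A * a ^ 2 - B * b ^ 2 - C * c ^ 2) / 4 := by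
  simp [Matrix.det_succ_row_zero, Fin.sum_univ_succ, Fin.succAbove]
  ring

lemma rat_scalar {p q : ℕ} {O : Subring (Bq p q)} (hO : IsOrder O) (c : ℚ)
    (h : algebraMap ℚ (Bq p q) c ∈ O) : ∃ n : ℤ, c = n := by
  obtain ⟨n, hn⟩ := order_norm hO h
  have h2 : Nrq (algebraMap ℚ (Bq p q) c) = c ^ 2 := by
    rw [Nrq_eq]
    have h1 : (algebraMap ℚ (Bq p q) c).re = c := rfl
    have h2 : (algebraMap ℚ (Bq p q) c).imI = 0 := rfl
    have h3 : (algebraMap ℚ (Bq p q) c).imJ = 0 := rfl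
    have h4 : (algebraMap ℚ (Bq p q) c).imK = 0 := rfl
    rw [h1, h2, h3, h4]; ring
  rw [h2] at hn
  have hi : IsIntegral ℤ c := by
    refine ⟨Polynomial.X ^ 2 - Polynomial.C n, Polynomial.monic_X_pow_sub_C n two_ne_zero, ?_⟩
    rw [Polynomial.eval₂_sub, Polynomial.eval₂_pow, Polynomial.eval₂_X, Polynomial.eval₂_C, hn]
    simp
  obtain ⟨m, hm⟩ := (IsIntegrallyClosed.isIntegral_iff).1 hi
  exact ⟨m, by rw [← hm]; rfl⟩

lemma prod_le {p q : ℕ} [Fact p.Prime] (hodd : Odd p) (hq : Nat.Prime q)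
    (hq8 : q % 8 = 3) (hqr : ∃ r : ℤ, (q : ℤ) ∣ r ^ 2 + p)
    {O : Subring (Bq p q)} (hO : IsMaximalOrder O) {x y z : Bq p q}
    (h : Red (GrossLat O) x y z) : Nrq x * Nrq y * Nrq z ≤ 8 * (p : ℚ) ^ 2 := by
  have hp0 : 0 < p := (Fact.out : p.Prime).pos
  have hq0 : 0 < q := hq.pos
  obtain ⟨ox, hox, ex⟩ := id h.hx
  obtain ⟨oy, hoy, ey⟩ := id h.hy
  obtain ⟨oz, hoz, ez⟩ := id h.hz
  have hmem : ∀ i, (![1, ox, oy, oz] : Fin 4 → Bq p q) i ∈ O := by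
    intro i; fin_cases i
    · exact O.one_mem
    · exact hox
    · exact hoy
    · exact hoz
  have hgen : ∀ w ∈ O, ∃ c : Fin 4 → ℤ, w = ∑ i, (c i : ℚ) • (![1, ox, oy, oz] : Fin 4 → Bq p q) i := by
    intro w hw
    obtain ⟨a, b, c, habc⟩ := gen_int hp0 hq0 h (2 * w - algebraMap ℚ (Bq p q) (Trq w)) ⟨w, hw, rfl⟩
    have hd : w - (a • ox + b • oy + c • oz) ∈ O :=
      O.sub_mem hw (O.add_mem (O.add_mem (zsmul_mem hox a) (zsmul_mem hoy b)) (zsmul_mem hoz c))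
    obtain ⟨r, hr⟩ : ∃ r : ℚ, w - (a • ox + b • oy + c • oz) = algebraMap ℚ (Bq p q) r := by
      refine ⟨(w - (a • ox + b • oy + c • oz)).re, ?_⟩
      rw [ex, ey, ez] at habc
      have i1 := congrArg (fun u : Bq p q => u.imI) habc
      have i2 := congrArg (fun u : Bq p q => u.imJ) habc
      have i3 := congrArg (fun u : Bq p q => u.imK) habc
      have h2 : ∀ r : ℚ, (algebraMap ℚ (Bq p q) r).imI = 0 := fun r => rfl
      have h3 : ∀ r : ℚ, (algebraMap ℚ (Bq p q) r).imJ = 0 := fun r => rfl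
      have h4 : ∀ r : ℚ, (algebraMap ℚ (Bq p q) r).imK = 0 := fun r => rfl
      simp only [two_mul, QuaternionAlgebra.imI_sub, QuaternionAlgebra.imI_smul,
        QuaternionAlgebra.imI_add, QuaternionAlgebra.imJ_sub, QuaternionAlgebra.imJ_add, QuaternionAlgebra.imJ_smul,
        QuaternionAlgebra.imK_sub, QuaternionAlgebra.imK_add, QuaternionAlgebra.imK_smul, h2, h3, h4, smul_eq_mul] at i1 i2 i3
      ext
      · rfl
      · rw [h2]; simp; linarith
      · rw [h3]; simp; linarith
      · rw [h4]; simp; linarith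
    rw [hr] at hd
    obtain ⟨n, rfl⟩ := rat_scalar hO.1 r hd
    refine ⟨![n, a, b, c], ?_⟩
    simp only [Fin.sum_univ_four, Matrix.cons_val_zero, Matrix.cons_val_one, Matrix.cons_val]
    rw [Algebra.algebraMap_eq_smul_one, sub_eq_iff_eq_add] at hr
    rw [hr]
    simp only [← Int.cast_smul_eq_zsmul ℚ]
    module
  obtain ⟨d, hd, hdp⟩ := disc_dvd hodd hq hq8 hqr O hO _ hmem hgen
  obtain ⟨a, ha⟩ : ∃ a, a = Trq (y * star z) / 2 := ⟨_, rfl⟩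
  obtain ⟨b, hb⟩ : ∃ b, b = Trq (x * star z) / 2 := ⟨_, rfl⟩
  obtain ⟨c, hc⟩ : ∃ c, c = Trq (x * star y) / 2 := ⟨_, rfl⟩
  have hG := red_gauss hp0 hq0 h a b c (by rw [ha]; ring) (by rw [hb]; ring) (by rw [hc]; ring)
  have hdet := det4 (Nrq x) (Nrq y) (Nrq z) a b c (Trq ox) (Trq oy) (Trq oz)
  have hM : (Matrix.of fun i j => Trq ((![1, ox, oy, oz] : Fin 4 → Bq p q) i * star ((![1, ox, oy, oz] : Fin 4 → Bq p q) j)))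
    = Matrix.of ![![2, Trq ox, Trq oy, Trq oz],
      ![Trq ox, (Nrq x + Trq ox ^ 2) / 2, (c + Trq ox * Trq oy) / 2, (b + Trq ox * Trq oz) / 2],
      ![Trq oy, (c + Trq ox * Trq oy) / 2, (Nrq y + Trq oy ^ 2) / 2, (a + Trq oy * Trq oz) / 2],
      ![Trq oz, (b + Trq ox * Trq oz) / 2, (a + Trq oy * Trq oz) / 2, (Nrq z + Trq oz ^ 2) / 2]] := by
    have nx := gross_nr ox
    have ny := gross_nr oy
    have nz := gross_nr oz
    have bxy := gross_bil ox oy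
    have bxz := gross_bil ox oz
    have byz := gross_bil oy oz
    rw [← ex] at nx bxy bxz
    rw [← ey] at ny bxy byz
    rw [← ez] at nz bxz byz
    have t1 : Trq (1 : Bq p q) = 2 := by simp [Trq]
    ext i j
    fin_cases i <;> fin_cases j
    · show Trq (1 * star (1 : Bq p q)) = 2
      rw [Trq_one_left, t1]
    · exact Trq_one_left ox
    · exact Trq_one_left oy
    · exact Trq_one_left oz
    · exact (Trq_comm _ _).trans (Trq_one_left ox)
    · show Trq (ox * star ox) = (Nrq x + Trq ox ^ 2) / 2
      rw [Trq_self]; linarith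
    · show Trq (ox * star oy) = (c + Trq ox * Trq oy) / 2
      linarith
    · show Trq (ox * star oz) = (b + Trq ox * Trq oz) / 2
      linarith
    · exact (Trq_comm _ _).trans (Trq_one_left oy)
    · show Trq (oy * star ox) = (c + Trq ox * Trq oy) / 2
      rw [Trq_comm]; linarith
    · show Trq (oy * star oy) = (Nrq y + Trq oy ^ 2) / 2
      rw [Trq_self]; linarith
    · show Trq (oy * star oz) = (a + Trq oy * Trq oz) / 2
      linarith
    · exact (Trq_comm _ _).trans (Trq_one_left oz)
    · show Trq (oz * star ox) = (b + Trq ox * Trq oz) / 2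
      rw [Trq_comm]; linarith
    · show Trq (oz * star oy) = (a + Trq oy * Trq oz) / 2
      rw [Trq_comm]; linarith
    · show Trq (oz * star oz) = (Nrq z + Trq oz ^ 2) / 2
      rw [Trq_self]; linarith
  rw [hM, hdet] at hd
  have hle : d ≤ (p : ℤ) ^ 2 := Int.le_of_dvd (by positivity) hdp
  have hle' : (d : ℚ) ≤ (p : ℚ) ^ 2 := by exact_mod_cast hle
  linarith

lemma D2_le {p q : ℕ} [Fact p.Prime] (hodd : Odd p) (hq : Nat.Prime q)
    (hq8 : q % 8 = 3) (hqr : ∃ r : ℤ, (q : ℤ) ∣ r ^ 2 + p)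
    {O : Subring (Bq p q)} (hO : IsMaximalOrder O) {x y z : Bq p q}
    (h : Red (GrossLat O) x y z) (h8 : 8 ≤ Nrq x) : Nrq y ≤ p := by
  have h1 := prod_le hodd hq hq8 hqr hO h
  obtain ⟨hl1, hl2⟩ := red_le h
  by_contra hlt
  push Not at hlt
  have hp0 : (0 : ℚ) ≤ p := by positivity
  have h2 : (p : ℚ) ^ 2 < Nrq y * Nrq z := by nlinarith
  have h3 : 8 * (Nrq y * Nrq z) ≤ Nrq x * (Nrq y * Nrq z) :=
    mul_le_mul_of_nonneg_right h8 (by nlinarith)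
  nlinarith

/-- integrality data -/
lemma int_data {p q : ℕ} {O : Subring (Bq p q)} (hO : IsOrder O) {x y : Bq p q}
    (hx : x ∈ GrossLat O) (hy : y ∈ GrossLat O) :
    ∃ N N' t t' m : ℤ, Nrq x = ((4 * N - t ^ 2 : ℤ) : ℚ) ∧ Nrq y = ((4 * N' - t' ^ 2 : ℤ) : ℚ) ∧
      Trq (x * star y) = 2 * ((2 * m - t * t' : ℤ) : ℚ) := by
  obtain ⟨o, ho, rfl⟩ := hx
  obtain ⟨o', ho', rfl⟩ := hy
  obtain ⟨N, hN⟩ := order_norm hO ho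
  obtain ⟨N', hN'⟩ := order_norm hO ho'
  obtain ⟨t, ht⟩ := order_trace hO ho
  obtain ⟨t', ht'⟩ := order_trace hO ho'
  obtain ⟨m, hm⟩ := order_bil hO ho ho'
  refine ⟨N, N', t, t', m, ?_, ?_, ?_⟩
  · rw [gross_nr, hN, ht]; push_cast; ring
  · rw [gross_nr, hN', ht']; push_cast; ring
  · rw [gross_bil, hm, ht, ht']; push_cast; ring

/-- multiples of an odd p which are even and in (0,2p) do not exist -/
lemma no_even (p n : ℤ) (hodd : p % 2 = 1) (hd : p ∣ n) (h0 : 0 < n) (h1 : n < 2 * p)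
    (he : n % 2 = 0) : False := by
  obtain ⟨k, rfl⟩ := hd
  have hp : 0 < p := by omega
  have k1 : 0 < k := by
    by_contra hk
    push Not at hk
    nlinarith
  have k2 : k < 2 := by
    by_contra hk
    push Not at hk
    nlinarith
  have : k = 1 := by omega
  subst this
  omega

lemma arith1 (p N N' t t' m : ℤ) (hp : Prime p) (hodd : p % 2 = 1)
    (hd : p ∣ (4 * N - t ^ 2) * (4 * N' - t' ^ 2) - (2 * m - t * t') ^ 2)
    (h0 : 0 < 4 * N - t ^ 2) (h1 : 4 * N - t ^ 2 ≤ 4 * N' - t' ^ 2) (h2 : 4 * N' - t' ^ 2 ≤ p)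
    (he : 2 * |2 * m - t * t'| = 4 * N - t ^ 2) : False := by
  have ht : t % 2 = 0 := by
    rcases Int.emod_two_eq_zero_or_one t with h | h
    · exact h
    · exfalso
      obtain ⟨k, hk⟩ : ∃ k, t = 2 * k + 1 := ⟨t / 2, by omega⟩
      subst hk
      ring_nf at he
      omega
  obtain ⟨k, rfl⟩ : ∃ k, t = 2 * k := ⟨t / 2, by omega⟩
  obtain ⟨s, hs⟩ : ∃ s, s = |2 * m - 2 * k * t'| := ⟨_, rfl⟩
  have hs2 : s ^ 2 = (2 * m - 2 * k * t') ^ 2 := by rw [hs, sq_abs]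
  rw [← hs] at he
  rw [← hs2] at hd
  obtain ⟨M, hM⟩ : ∃ M, M = N - k ^ 2 := ⟨_, rfl⟩
  have e1 : 4 * N - (2 * k) ^ 2 = 4 * M := by rw [hM]; ring
  rw [e1] at he hd h0 h1
  obtain ⟨E, hE⟩ : ∃ E, E = 4 * N' - t' ^ 2 := ⟨_, rfl⟩
  rw [← hE] at hd h1 h2
  have hsM : s = 2 * M := by omega
  subst hsM
  have : 4 * M * E - (2 * M) ^ 2 = (2 * M) * (2 * E - 2 * M) := by ring
  rw [this] at hd
  rcases hp.dvd_or_dvd hd with h | h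
  · have := Int.le_of_dvd (by omega) h
    omega
  · exact no_even p _ hodd h (by omega) (by omega) (by omega)

lemma arith2 (p N N' t t' m : ℤ) (hp : Prime p) (hodd : p % 2 = 1)
    (hd : p ∣ (4 * N - t ^ 2) * (4 * N' - t' ^ 2) - (2 * m - t * t') ^ 2)
    (h0 : 0 < 4 * N - t ^ 2) (h1 : 4 * N - t ^ 2 = 4 * N' - t' ^ 2) (h2 : 4 * N' - t' ^ 2 ≤ p)
    (he : 2 * |2 * m - t * t'| ≤ 4 * N - t ^ 2) : False := by
  have hpar : ((4 * N' - t' ^ 2) - (2 * m - t * t')) % 2 = 0 := by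
    rcases Int.emod_two_eq_zero_or_one t with h | h <;>
    rcases Int.emod_two_eq_zero_or_one t' with h' | h'
    · obtain ⟨k, rfl⟩ : ∃ k, t = 2 * k := ⟨t / 2, by omega⟩
      obtain ⟨l, rfl⟩ : ∃ l, t' = 2 * l := ⟨t' / 2, by omega⟩
      ring_nf; omega
    · obtain ⟨k, rfl⟩ : ∃ k, t = 2 * k := ⟨t / 2, by omega⟩
      obtain ⟨l, rfl⟩ : ∃ l, t' = 2 * l + 1 := ⟨t' / 2, by omega⟩
      exfalso
      ring_nf at h1; omega
    · obtain ⟨k, rfl⟩ : ∃ k, t = 2 * k + 1 := ⟨t / 2, by omega⟩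
      obtain ⟨l, rfl⟩ : ∃ l, t' = 2 * l := ⟨t' / 2, by omega⟩
      exfalso
      ring_nf at h1; omega
    · obtain ⟨k, rfl⟩ : ∃ k, t = 2 * k + 1 := ⟨t / 2, by omega⟩
      obtain ⟨l, rfl⟩ : ∃ l, t' = 2 * l + 1 := ⟨t' / 2, by omega⟩
      ring_nf; omega
  rw [h1] at hd h0 he
  obtain ⟨E, hE⟩ : ∃ E, E = 4 * N' - t' ^ 2 := ⟨_, rfl⟩
  obtain ⟨s, hs⟩ : ∃ s, s = 2 * m - t * t' := ⟨_, rfl⟩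
  rw [← hE, ← hs] at hpar hd he
  rw [← hE] at h2 h0
  have habs : |s| ≤ E / 2 := by omega
  rw [abs_le] at habs
  have : E * E - s ^ 2 = (E - s) * (E + s) := by ring
  rw [this] at hd
  rcases hp.dvd_or_dvd hd with h | h
  · exact no_even p _ hodd h (by omega) (by omega) (by omega)
  · exact no_even p _ hodd h (by omega) (by omega) (by omega)

lemma case1 {p q : ℕ} [Fact p.Prime] (hodd : Odd p) (hq : Nat.Prime q)
    (hq8 : q % 8 = 3) (hqr : ∃ r : ℤ, (q : ℤ) ∣ r ^ 2 + p)
    {O : Subring (Bq p q)} (hO : IsMaximalOrder O) {x y z : Bq p q}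
    (h : Red (GrossLat O) x y z) (hle : Nrq y ≤ p) :
    |Trq (x * star y)| < Nrq x ∧ Nrq x ≠ Nrq y := by
  have hP : p.Prime := Fact.out
  have hP' : Prime (p : ℤ) := Nat.prime_iff_prime_int.1 hP
  have ho : (p : ℤ) % 2 = 1 := by
    have := Nat.odd_iff.1 hodd
    omega
  obtain ⟨N, N', t, t', m, e1, e2, e3⟩ := int_data hO.1 h.hx h.hy
  have hd := local_dvd hodd hq hq8 hqr x y (gross_re h.hx) (gross_re h.hy) _ _ _ e1 e2 e3
  have hpos := red_pos hP.pos hq.pos h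
  have hl := (red_le h).1
  have hxy := red_xy h
  rw [e1] at hpos hl hxy ⊢
  rw [e2] at hl hle ⊢
  rw [e3] at hxy ⊢
  have h0 : 0 < 4 * N - t ^ 2 := by exact_mod_cast hpos
  have h1 : 4 * N - t ^ 2 ≤ 4 * N' - t' ^ 2 := by exact_mod_cast hl
  have h2 : 4 * N' - t' ^ 2 ≤ p := by exact_mod_cast hle
  rw [abs_mul, abs_two] at hxy ⊢
  have h3 : 2 * |2 * m - t * t'| ≤ 4 * N - t ^ 2 := by exact_mod_cast hxy
  constructor
  · apply lt_of_le_of_ne hxy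
    intro he
    have he' : 2 * |2 * m - t * t'| = 4 * N - t ^ 2 := by exact_mod_cast he
    exact arith1 p N N' t t' m hP' ho hd h0 h1 h2 he'
  · intro he
    have he' : 4 * N - t ^ 2 = 4 * N' - t' ^ 2 := by exact_mod_cast he
    exact arith2 p N N' t t' m hP' ho hd h0 he' h2 h3

end GrossPaper

open GrossPaper

/-- Lemma triv-cases: `|Tr(x·ȳ)| < D₁`, `|Tr(x'·ȳ')| < D₁'`, `D₁ ≠ D₂`. -/
theorem triv_cases (p q : ℕ) (hp : Nat.Prime p) (hodd : Odd p) (hq : Nat.Prime q)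
    (hq8 : q % 8 = 3) (hqr : ∃ r : ℤ, (q : ℤ) ∣ r ^ 2 + p)
    (O O' : Subring (Bq p q)) (hO : IsMaximalOrder O) (hO' : IsMaximalOrder O')
    (D₁ D₂ D₃ D₁' D₂' D₃' : ℝ) (x y z x' y' z' : Bq p q)
    (hm1 : SuccMin (GrossLat O) 1 D₁) (hm2 : SuccMin (GrossLat O) 2 D₂)
    (hm3 : SuccMin (GrossLat O) 3 D₃)
    (hx : x ∈ GrossLat O) (hy : y ∈ GrossLat O) (hz : z ∈ GrossLat O)
    (hxD : (Nrq x : ℝ) = D₁) (hyD : (Nrq y : ℝ) = D₂) (hzD : (Nrq z : ℝ) = D₃)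
    (hxy : LinearIndependent ℚ ![x, y])
    (hzxy : z ∉ Submodule.span ℚ ({x, y} : Set (Bq p q)))
    (hm1' : SuccMin (GrossLat O') 1 D₁') (hm2' : SuccMin (GrossLat O') 2 D₂')
    (hm3' : SuccMin (GrossLat O') 3 D₃')
    (hx' : x' ∈ GrossLat O') (hy' : y' ∈ GrossLat O') (hz' : z' ∈ GrossLat O')
    (hxD' : (Nrq x' : ℝ) = D₁') (hyD' : (Nrq y' : ℝ) = D₂') (hzD' : (Nrq z' : ℝ) = D₃')
    (hxy' : LinearIndependent ℚ ![x', y'])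
    (hzxy' : z' ∉ Submodule.span ℚ ({x', y'} : Set (Bq p q)))
    (h8 : (8 : ℝ) ≤ D₁) (hD2le : D₂' ≤ D₂) :
    |(Trq (x * star y) : ℝ)| < D₁ ∧ |(Trq (x' * star y') : ℝ)| < D₁' ∧ D₁ ≠ D₂ := by
  haveI : Fact p.Prime := ⟨hp⟩
  have R := red_of hm1 hm2 hm3 hx hy hz hxD hyD hzD hxy hzxy
  have R' := red_of hm1' hm2' hm3' hx' hy' hz' hxD' hyD' hzD' hxy' hzxy'
  subst hxD hyD hxD' hyD'
  have h8' : (8 : ℚ) ≤ Nrq x := by exact_mod_cast h8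
  have hle := D2_le hodd hq hq8 hqr hO R h8'
  have hle2 : Nrq y' ≤ Nrq y := by exact_mod_cast hD2le
  obtain ⟨c1, c2⟩ := case1 hodd hq hq8 hqr hO R hle
  obtain ⟨c3, -⟩ := case1 hodd hq hq8 hqr hO' R' (hle2.trans hle)
  refine ⟨by exact_mod_cast c1, by exact_mod_cast c3, by exact_mod_cast c2⟩
end

section
/- Let O be a maximal order of B_p with x, y realizing the first two successive minima D₁, D₂ of O^T. Then 4·D₁·D₂ − Tr(x·ȳ)² is a positive integer divisible by 16p; in particular D₁·D₂ − ¼·Tr(x·ȳ)² ≥ 4p. -/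
open scoped Quaternion

open GrossPaper


namespace GrossAux

lemma unit1 (p : ℕ) [Fact p.Prime] (m : ℤ) (hm : ¬ IsSquare ((-m : ℤ) : ZMod p)) (u v : ℤ_[p])
    (h : IsUnit u ∨ IsUnit v) : ‖u ^ 2 + (m : ℤ_[p]) * v ^ 2‖ = 1 := by
  by_contra hne
  have hlt : ‖u ^ 2 + (m : ℤ_[p]) * v ^ 2‖ < 1 := lt_of_le_of_ne (PadicInt.norm_le_one _) hne
  have h0 : PadicInt.toZMod (u ^ 2 + (m : ℤ_[p]) * v ^ 2) = 0 := by
    rw [← RingHom.mem_ker, PadicInt.ker_toZMod, IsLocalRing.mem_maximalIdeal,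
      PadicInt.mem_nonunits]
    exact hlt
  simp only [map_add, map_mul, map_pow, map_intCast] at h0
  apply hm
  rcases h with h | h
  · have hu := (h.map (PadicInt.toZMod (p := p))).ne_zero
    set a := PadicInt.toZMod u
    set b := PadicInt.toZMod v
    refine ⟨(m : ZMod p) * b / a, ?_⟩
    field_simp
    push_cast
    linear_combination (-(m : ZMod p)) * h0
  · have hu := (h.map (PadicInt.toZMod (p := p))).ne_zero
    set a := PadicInt.toZMod u
    set b := PadicInt.toZMod v
    refine ⟨a / b, ?_⟩
    field_simp
    push_cast
    linear_combination -h0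

lemma norm_form (p : ℕ) [Fact p.Prime] (m : ℤ) (hm : ¬ IsSquare ((-m : ℤ) : ZMod p))
    (A C : ℚ_[p]) (h : A ≠ 0 ∨ C ≠ 0) :
    ∃ n : ℤ, ‖A ^ 2 + m * C ^ 2‖ = (p : ℝ) ^ (2 * n) ∧ ‖A‖ ≤ (p : ℝ) ^ n ∧ ‖C‖ ≤ (p : ℝ) ^ n := by
  rcases le_total ‖C‖ ‖A‖ with hle | hle
  · have hA : A ≠ 0 := by
      rintro rfl
      simp at hle
      simp [hle] at h
    have hA' : 0 < ‖A‖ := norm_pos_iff.2 hA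
    have hT : ‖C / A‖ ≤ 1 := by rw [norm_div]; exact div_le_one_of_le₀ hle hA'.le
    obtain ⟨T, hT'⟩ : ∃ T : ℤ_[p], (T : ℚ_[p]) = C / A := ⟨⟨_, hT⟩, rfl⟩
    have := unit1 p m hm 1 T (Or.inl isUnit_one)
    rw [PadicInt.norm_def] at this
    push_cast at this
    rw [hT'] at this
    refine ⟨-A.valuation, ?_, ?_, ?_⟩
    · have e : A ^ 2 + m * C ^ 2 = A ^ 2 * (1 ^ 2 + m * (C / A) ^ 2) := by field_simp; try ring
      rw [e, norm_mul, this, mul_one, norm_pow, Padic.norm_eq_zpow_neg_valuation hA, mul_comm,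
        zpow_mul]
      norm_cast
    · rw [Padic.norm_eq_zpow_neg_valuation hA]
    · rw [← Padic.norm_eq_zpow_neg_valuation hA]; exact hle
  · have hA : C ≠ 0 := by
      rintro rfl
      simp at hle
      simp [hle] at h
    have hA' : 0 < ‖C‖ := norm_pos_iff.2 hA
    have hT : ‖A / C‖ ≤ 1 := by rw [norm_div]; exact div_le_one_of_le₀ hle hA'.le
    obtain ⟨T, hT'⟩ : ∃ T : ℤ_[p], (T : ℚ_[p]) = A / C := ⟨⟨_, hT⟩, rfl⟩
    have := unit1 p m hm T 1 (Or.inr isUnit_one)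
    rw [PadicInt.norm_def] at this
    push_cast at this
    rw [hT'] at this
    refine ⟨-C.valuation, ?_, ?_, ?_⟩
    · have e : A ^ 2 + m * C ^ 2 = C ^ 2 * ((A / C) ^ 2 + m * 1 ^ 2) := by field_simp
      rw [e, norm_mul, this, mul_one, norm_pow, Padic.norm_eq_zpow_neg_valuation hA, mul_comm,
        zpow_mul]
      norm_cast
    · rw [← Padic.norm_eq_zpow_neg_valuation hA]; exact hle
    · rw [Padic.norm_eq_zpow_neg_valuation hA]

lemma integ (p : ℕ) [hp : Fact p.Prime] (m : ℤ) (hm : ¬ IsSquare ((-m : ℤ) : ZMod p))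
    (A C B D : ℚ_[p]) (h : ‖(A ^ 2 + m * C ^ 2) + p * (B ^ 2 + m * D ^ 2)‖ ≤ 1) :
    (‖A‖ ≤ 1 ∧ ‖C‖ ≤ 1) ∧ (‖B‖ ≤ 1 ∧ ‖D‖ ≤ 1) := by
  have hp1 : (1 : ℝ) < p := by exact_mod_cast hp.out.one_lt
  have hp0 : (p : ℝ) ≠ 0 := by positivity
  have key : ∀ n : ℤ, (p : ℝ) ^ n ≤ 1 ↔ n ≤ 0 := fun n => by
    rw [← zpow_zero (p : ℝ), zpow_le_zpow_iff_right₀ hp1]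
  have both : ‖A ^ 2 + m * C ^ 2‖ ≤ 1 ∧ ‖(p : ℚ_[p]) * (B ^ 2 + m * D ^ 2)‖ ≤ 1 := by
    by_cases h1 : A ≠ 0 ∨ C ≠ 0
    · by_cases h2 : B ≠ 0 ∨ D ≠ 0
      · obtain ⟨n, hn, -⟩ := norm_form p m hm A C h1
        obtain ⟨k, hk, -⟩ := norm_form p m hm B D h2
        have hk' : ‖(p : ℚ_[p]) * (B ^ 2 + m * D ^ 2)‖ = (p : ℝ) ^ (2 * k - 1) := by
          rw [norm_mul, hk, Padic.norm_p, zpow_sub_one₀ hp0, mul_comm]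
        have hne : ‖A ^ 2 + m * C ^ 2‖ ≠ ‖(p : ℚ_[p]) * (B ^ 2 + m * D ^ 2)‖ := by
          rw [hn, hk']
          intro e
          have := zpow_right_injective₀ (by positivity) hp1.ne' e
          omega
        rw [Padic.add_eq_max_of_ne hne] at h
        exact max_le_iff.1 h
      · push Not at h2
        simpa [h2.1, h2.2] using h
    · push Not at h1
      simpa [h1.1, h1.2] using h
  constructor
  · by_cases h1 : A ≠ 0 ∨ C ≠ 0
    · obtain ⟨n, hn, ha, hc⟩ := norm_form p m hm A C h1
      have := both.1
      rw [hn, key] at this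
      have h3 := (key n).2 (by omega)
      exact ⟨ha.trans h3, hc.trans h3⟩
    · push Not at h1
      simp [h1.1, h1.2]
  · by_cases h2 : B ≠ 0 ∨ D ≠ 0
    · obtain ⟨k, hk, hb, hd⟩ := norm_form p m hm B D h2
      have := both.2
      rw [norm_mul, hk, Padic.norm_p, mul_comm, ← zpow_sub_one₀ hp0, key] at this
      have h3 := (key k).2 (by omega)
      exact ⟨hb.trans h3, hd.trans h3⟩
    · push Not at h2
      simp [h2.1, h2.2]

lemma nonres (p q : ℕ) (hp : p.Prime) (hodd : Odd p) (hq : q.Prime)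
    (hq8 : q % 8 = 3) (hqr : ∃ r : ℤ, (q : ℤ) ∣ r ^ 2 + p) (hpq : p ≠ q) :
    ¬ IsSquare ((-(q : ℤ) : ℤ) : ZMod p) := by
  have := Fact.mk hp
  have := Fact.mk hq
  have hp2 : p ≠ 2 := by rintro rfl; revert hodd; decide
  have hq2 : q ≠ 2 := by rintro rfl; omega
  have hpq0 : ((p : ℤ) : ZMod q) ≠ 0 := by
    have := (Nat.coprime_primes hq hp).2 (Ne.symm hpq)
    intro h
    have h' : ((p : ℕ) : ZMod q) = 0 := by exact_mod_cast h
    rw [ZMod.natCast_eq_zero_iff] at h'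
    exact hpq ((Nat.prime_dvd_prime_iff_eq hq hp).1 h').symm
  have h1 : legendreSym q (-(p : ℤ)) = 1 := by
    rw [legendreSym.eq_one_iff q (by simpa using hpq0)]
    obtain ⟨r, hr⟩ := hqr
    refine ⟨(r : ZMod q), ?_⟩
    have := (ZMod.intCast_zmod_eq_zero_iff_dvd _ q).2 hr
    push_cast at this ⊢
    linear_combination -this
  have hneg : ∀ (l : ℕ) [Fact l.Prime] (z : ℤ), legendreSym l (-z) = legendreSym l (-1) * legendreSym l z := by
    intro l _ z
    rw [← legendreSym.mul]; simp
  rw [hneg, legendreSym.at_neg_one hq2, ZMod.χ₄_nat_three_mod_four (by omega)] at h1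
  rw [← legendreSym.eq_neg_one_iff, hneg, legendreSym.at_neg_one hp2]
  have hpo := Nat.odd_iff.1 hodd
  rcases (by omega : p % 4 = 1 ∨ p % 4 = 3) with h | h
  · rw [ZMod.χ₄_nat_one_mod_four h,
      legendreSym.quadratic_reciprocity_one_mod_four h hq2] at *
    linarith
  · rw [ZMod.χ₄_nat_three_mod_four h,
      legendreSym.quadratic_reciprocity_three_mod_four (p := q) (q := p) (by omega) h]
    linarith

lemma nonres1 (p : ℕ) (hp : p.Prime) (hq8 : p % 8 = 3) :
    ¬ IsSquare ((-(1 : ℤ) : ℤ) : ZMod p) := by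
  have := Fact.mk hp
  push_cast
  rw [ZMod.exists_sq_eq_neg_one_iff]
  omega

lemma rat_int (r : ℚ) (M : ℕ) (hM : 0 < M) (h : ∀ n : ℕ, ∃ z : ℤ, (M : ℚ) * r ^ n = z) :
    ∃ z : ℤ, r = z := by
  have hd : ∀ n : ℕ, r.den ^ n ∣ M := by
    intro n
    obtain ⟨z, hz⟩ := h n
    have h1 : (r ^ n) = (z : ℚ) / (M : ℤ) := by
      push_cast; field_simp; linarith
    have h2 : (((r ^ n).den : ℕ) : ℤ) ∣ (M : ℤ) := by
      rw [h1, ← Rat.divInt_eq_div]; exact Rat.den_dvd _ _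
    rw [Rat.den_pow] at h2
    exact_mod_cast h2
  have : r.den = 1 := by
    by_contra hne
    have h2 : 2 ≤ r.den := by have := r.den_pos; omega
    have h3 := Nat.le_of_dvd hM (hd M)
    have h4 : 2 ^ M ≤ r.den ^ M := Nat.pow_le_pow_left h2 M
    have h5 := M.lt_two_pow_self
    omega
  exact ⟨r.num, by rw [← Rat.den_eq_one_iff r |>.1 this]; simp⟩

variable {p q : ℕ}

lemma Nrq_eq (a : Bq p q) :
    Nrq a = a.re ^ 2 + p * a.imI ^ 2 + q * a.imJ ^ 2 + p * q * a.imK ^ 2 := by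
  simp [Nrq]
  ring

lemma Nrq_mul (a b : Bq p q) : Nrq (a * b) = Nrq a * Nrq b := by
  simp [Nrq_eq]
  ring

lemma Nrq_pow (a : Bq p q) (n : ℕ) : Nrq (a ^ n) = Nrq a ^ n := by
  induction n with
  | zero => simp [Nrq_eq]
  | succ k ih => rw [pow_succ, Nrq_mul, ih, pow_succ]

/-- all coordinates times `M` are integers -/
def coordInt (M : ℕ) (a : Bq p q) : Prop :=
  (∃ z : ℤ, (M : ℚ) * a.re = z) ∧ (∃ z : ℤ, (M : ℚ) * a.imI = z) ∧
  (∃ z : ℤ, (M : ℚ) * a.imJ = z) ∧ (∃ z : ℤ, (M : ℚ) * a.imK = z)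

lemma coordInt_exists (a : Bq p q) : ∃ M : ℕ, 0 < M ∧ coordInt M a := by
  refine ⟨a.re.den * a.imI.den * a.imJ.den * a.imK.den, ?_, ⟨a.re.num * a.imI.den * a.imJ.den * a.imK.den, ?_⟩,
    ⟨a.re.den * a.imI.num * a.imJ.den * a.imK.den, ?_⟩, ⟨a.re.den * a.imI.den * a.imJ.num * a.imK.den, ?_⟩,
    ⟨a.re.den * a.imI.den * a.imJ.den * a.imK.num, ?_⟩⟩
  · have := a.re.den_pos
    have := a.imI.den_pos
    have := a.imJ.den_pos
    have := a.imK.den_pos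
    positivity
  · push_cast; linear_combination (a.imI.den * a.imJ.den * a.imK.den : ℚ) * Rat.mul_den_eq_num a.re
  · push_cast; linear_combination (a.re.den * a.imJ.den * a.imK.den : ℚ) * Rat.mul_den_eq_num a.imI
  · push_cast; linear_combination (a.re.den * a.imI.den * a.imK.den : ℚ) * Rat.mul_den_eq_num a.imJ
  · push_cast; linear_combination (a.re.den * a.imI.den * a.imJ.den : ℚ) * Rat.mul_den_eq_num a.imK

lemma coordInt_mul {M : ℕ} {a : Bq p q} (h : coordInt M a) (N : ℕ) : coordInt (N * M) a := by
  obtain ⟨⟨x, hx⟩, ⟨y, hy⟩, ⟨z, hz⟩, ⟨w, hw⟩⟩ := h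
  refine ⟨⟨N * x, ?_⟩, ⟨N * y, ?_⟩, ⟨N * z, ?_⟩, ⟨N * w, ?_⟩⟩ <;> push_cast
  · rw [← hx]; ring
  · rw [← hy]; ring
  · rw [← hz]; ring
  · rw [← hw]; ring

lemma coordInt_add {M : ℕ} {a b : Bq p q} (h : coordInt M a) (h' : coordInt M b) :
    coordInt M (a + b) := by
  obtain ⟨⟨x, hx⟩, ⟨y, hy⟩, ⟨z, hz⟩, ⟨w, hw⟩⟩ := h
  obtain ⟨⟨x', hx'⟩, ⟨y', hy'⟩, ⟨z', hz'⟩, ⟨w', hw'⟩⟩ := h'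
  refine ⟨⟨x + x', ?_⟩, ⟨y + y', ?_⟩, ⟨z + z', ?_⟩, ⟨w + w', ?_⟩⟩ <;> simp [mul_add, *]

lemma coordInt_zsmul {M : ℕ} {a : Bq p q} (h : coordInt M a) (n : ℤ) :
    coordInt M (n • a) := by
  obtain ⟨⟨x, hx⟩, ⟨y, hy⟩, ⟨z, hz⟩, ⟨w, hw⟩⟩ := h
  refine ⟨⟨n * x, ?_⟩, ⟨n * y, ?_⟩, ⟨n * z, ?_⟩, ⟨n * w, ?_⟩⟩ <;> simp
  · rw [← hx]; ring
  · rw [← hy]; ring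
  · rw [← hz]; ring
  · rw [← hw]; ring

lemma order_coord (O : Subring (Bq p q)) (hO : IsOrder O) :
    ∃ M : ℕ, 0 < M ∧ ∀ a ∈ O, coordInt M a := by
  obtain ⟨⟨b⟩, -⟩ := hO
  choose M hM hMc using fun i => coordInt_exists ((b i : O) : Bq p q)
  refine ⟨∏ i, M i, Finset.prod_pos fun i _ => hM i, ?_⟩
  intro a ha
  have hb : ∀ i, coordInt (∏ i, M i) ((b i : O) : Bq p q) := by
    intro i
    obtain ⟨N, hN⟩ := Finset.dvd_prod_of_mem M (Finset.mem_univ i)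
    rw [hN, mul_comm]
    exact coordInt_mul (hMc i) N
  have hs := congrArg (Subtype.val) (b.sum_repr ⟨a, ha⟩)
  rw [Fin.sum_univ_four] at hs
  have hs' : a = (b.repr ⟨a, ha⟩ 0) • ((b 0 : O) : Bq p q) + (b.repr ⟨a, ha⟩ 1) • ((b 1 : O) : Bq p q)
     + (b.repr ⟨a, ha⟩ 2) • ((b 2 : O) : Bq p q) + (b.repr ⟨a, ha⟩ 3) • ((b 3 : O) : Bq p q) := hs.symm
  rw [hs']
  exact coordInt_add (coordInt_add (coordInt_add (coordInt_zsmul (hb 0) _) (coordInt_zsmul (hb 1) _))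
    (coordInt_zsmul (hb 2) _)) (coordInt_zsmul (hb 3) _)

lemma order_norm (O : Subring (Bq p q)) (hO : IsOrder O) (a : Bq p q) (ha : a ∈ O) :
    ∃ z : ℤ, Nrq a = z := by
  obtain ⟨M, hM, h⟩ := order_coord O hO
  refine rat_int (Nrq a) (M ^ 2) (by positivity) fun n => ?_
  rw [← Nrq_pow, Nrq_eq]
  obtain ⟨⟨x, hx⟩, ⟨y, hy⟩, ⟨z, hz⟩, ⟨w, hw⟩⟩ := h _ (O.pow_mem ha n)
  refine ⟨x ^ 2 + p * y ^ 2 + q * z ^ 2 + p * q * w ^ 2, ?_⟩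
  push_cast
  rw [← hx, ← hy, ← hz, ← hw]
  ring

lemma comm_dvd (p q : ℕ) (hp : Nat.Prime p) (hodd : Odd p) (hq : Nat.Prime q)
    (hq8 : q % 8 = 3) (hqr : ∃ r : ℤ, (q : ℤ) ∣ r ^ 2 + p)
    (O : Subring (Bq p q)) (hO : IsOrder O) (a b : Bq p q) (ha : a ∈ O) (hb : b ∈ O) :
    ∃ z : ℤ, Nrq (a * b - b * a) = z ∧ (p : ℤ) ∣ z := by
  have := Fact.mk hp
  obtain ⟨z, hz⟩ := order_norm O hO _ (O.sub_mem (O.mul_mem ha hb) (O.mul_mem hb ha))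
  obtain ⟨u, hu⟩ := order_norm O hO a ha
  obtain ⟨v, hv⟩ := order_norm O hO b hb
  refine ⟨z, hz, ?_⟩
  rw [Nrq_eq] at hz hu hv
  have hz' := congrArg (fun t : ℚ => (t : ℚ_[p])) hz
  have hu' := congrArg (fun t : ℚ => (t : ℚ_[p])) hu
  have hv' := congrArg (fun t : ℚ => (t : ℚ_[p])) hv
  simp at hz' hu' hv'
  suffices ∃ s : ℤ_[p], (z : ℤ_[p]) = p * s by
    obtain ⟨s, hs⟩ := this
    rw [← PadicInt.norm_int_lt_one_iff_dvd, hs, norm_mul]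
    have h1 : ‖(p : ℤ_[p])‖ < 1 := by
      rw [PadicInt.norm_p]
      exact inv_lt_one_of_one_lt₀ (by exact_mod_cast hp.one_lt)
    nlinarith [PadicInt.norm_le_one s, norm_nonneg s, norm_nonneg (p : ℤ_[p])]
  generalize (a.re : ℚ_[p]) = a0 at *
  generalize (a.imI : ℚ_[p]) = a1 at *
  generalize (a.imJ : ℚ_[p]) = a2 at *
  generalize (a.imK : ℚ_[p]) = a3 at *
  generalize (b.re : ℚ_[p]) = b0 at *
  generalize (b.imI : ℚ_[p]) = b1 at *
  generalize (b.imJ : ℚ_[p]) = b2 at *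
  generalize (b.imK : ℚ_[p]) = b3 at *
  by_cases hpq : p = q
  · subst hpq
    have hm := nonres1 p hp hq8
    obtain ⟨⟨-, h3⟩, h1, h2⟩ := integ p 1 hm a0 (p * a3) a1 a2 (by
      have := Padic.norm_int_le_one (p := p) u
      rw [← hu'] at this
      convert this using 2
      push_cast; ring)
    obtain ⟨⟨-, k3⟩, k1, k2⟩ := integ p 1 hm b0 (p * b3) b1 b2 (by
      have := Padic.norm_int_le_one (p := p) v
      rw [← hv'] at this
      convert this using 2
      push_cast; ring)
    obtain ⟨x1, eh1⟩ : ∃ T : ℤ_[p], (T : ℚ_[p]) = a1 := ⟨⟨_, h1⟩, rfl⟩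
    obtain ⟨x2, eh2⟩ : ∃ T : ℤ_[p], (T : ℚ_[p]) = a2 := ⟨⟨_, h2⟩, rfl⟩
    obtain ⟨x3, eh3⟩ : ∃ T : ℤ_[p], (T : ℚ_[p]) = p * a3 := ⟨⟨_, h3⟩, rfl⟩
    obtain ⟨y1, ek1⟩ : ∃ T : ℤ_[p], (T : ℚ_[p]) = b1 := ⟨⟨_, k1⟩, rfl⟩
    obtain ⟨y2, ek2⟩ : ∃ T : ℤ_[p], (T : ℚ_[p]) = b2 := ⟨⟨_, k2⟩, rfl⟩
    obtain ⟨y3, ek3⟩ : ∃ T : ℤ_[p], (T : ℚ_[p]) = p * b3 := ⟨⟨_, k3⟩, rfl⟩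
    refine ⟨(1 + 1 + 1 + 1) * ((x2 * y3 - x3 * y2) ^ 2 + (x1 * y3 - x3 * y1) ^ 2 + p * (x1 * y2 - x2 * y1) ^ 2), ?_⟩
    apply Subtype.ext
    push_cast
    rw [← hz', eh1, eh2, eh3, ek1, ek2, ek3]
    ring
  · have hm := nonres p q hp hodd hq hq8 hqr hpq
    obtain ⟨⟨-, h2⟩, h1, h3⟩ := integ p q hm a0 a2 a1 a3 (by
      have := Padic.norm_int_le_one (p := p) u
      rw [← hu'] at this
      convert this using 2
      push_cast; ring)
    obtain ⟨⟨-, k2⟩, k1, k3⟩ := integ p q hm b0 b2 b1 b3 (by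
      have := Padic.norm_int_le_one (p := p) v
      rw [← hv'] at this
      convert this using 2
      push_cast; ring)
    obtain ⟨x1, eh1⟩ : ∃ T : ℤ_[p], (T : ℚ_[p]) = a1 := ⟨⟨_, h1⟩, rfl⟩
    obtain ⟨x2, eh2⟩ : ∃ T : ℤ_[p], (T : ℚ_[p]) = a2 := ⟨⟨_, h2⟩, rfl⟩
    obtain ⟨x3, eh3⟩ : ∃ T : ℤ_[p], (T : ℚ_[p]) = a3 := ⟨⟨_, h3⟩, rfl⟩
    obtain ⟨y1, ek1⟩ : ∃ T : ℤ_[p], (T : ℚ_[p]) = b1 := ⟨⟨_, k1⟩, rfl⟩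
    obtain ⟨y2, ek2⟩ : ∃ T : ℤ_[p], (T : ℚ_[p]) = b2 := ⟨⟨_, k2⟩, rfl⟩
    obtain ⟨y3, ek3⟩ : ∃ T : ℤ_[p], (T : ℚ_[p]) = b3 := ⟨⟨_, k3⟩, rfl⟩
    refine ⟨(1 + 1 + 1 + 1) * (q ^ 2 * (x2 * y3 - x3 * y2) ^ 2 + p * q * (x1 * y3 - x3 * y1) ^ 2 + q * (x1 * y2 - x2 * y1) ^ 2), ?_⟩
    apply Subtype.ext
    push_cast
    rw [← hz', eh1, eh2, eh3, ek1, ek2, ek3]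
    ring

lemma gross_eq (a b : Bq p q) :
    4 * Nrq (2 * a - algebraMap ℚ (Bq p q) (Trq a)) * Nrq (2 * b - algebraMap ℚ (Bq p q) (Trq b)) -
      (Trq ((2 * a - algebraMap ℚ (Bq p q) (Trq a)) * star (2 * b - algebraMap ℚ (Bq p q) (Trq b)))) ^ 2
    = 16 * Nrq (a * b - b * a) := by
  have h : ∀ c : Bq p q, 2 * c - algebraMap ℚ (Bq p q) (Trq c) = ⟨0, 2 * c.imI, 2 * c.imJ, 2 * c.imK⟩ := by
    intro c
    have e : algebraMap ℚ (Bq p q) (Trq c) = ⟨2 * c.re, 0, 0, 0⟩ := rfl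
    rw [two_mul, e]
    ext <;> simp <;> ring
  rw [h, h]
  simp [Nrq_eq, Trq]
  ring

lemma pos (hp : 0 < p) (hq : 0 < q) (a b : Bq p q)
    (h : LinearIndependent ℚ ![2 * a - algebraMap ℚ (Bq p q) (Trq a), 2 * b - algebraMap ℚ (Bq p q) (Trq b)]) :
    0 < Nrq (a * b - b * a) := by
  have h2 : ∀ c : Bq p q, 2 * c - algebraMap ℚ (Bq p q) (Trq c) = ⟨0, 2 * c.imI, 2 * c.imJ, 2 * c.imK⟩ := by
    intro c
    have e : algebraMap ℚ (Bq p q) (Trq c) = ⟨2 * c.re, 0, 0, 0⟩ := rfl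
    rw [two_mul, e]
    ext <;> simp <;> ring
  rw [h2, h2, LinearIndependent.pair_iff] at h
  have hp' : (0 : ℚ) < p := by exact_mod_cast hp
  have hq' : (0 : ℚ) < q := by exact_mod_cast hq
  have e : Nrq (a * b - b * a) = 4 * (p * q * q * (a.imJ * b.imK - a.imK * b.imJ) ^ 2
      + p * p * q * (a.imI * b.imK - a.imK * b.imI) ^ 2 + p * q * (a.imI * b.imJ - a.imJ * b.imI) ^ 2) := by
    simp [Nrq_eq]
    ring
  by_contra hle
  rw [e, not_lt] at hle
  have p1 : 0 ≤ p * q * q * (a.imJ * b.imK - a.imK * b.imJ) ^ 2 := by positivity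
  have p2 : 0 ≤ p * p * q * (a.imI * b.imK - a.imK * b.imI) ^ 2 := by positivity
  have p3 : 0 ≤ p * q * (a.imI * b.imJ - a.imJ * b.imI) ^ 2 := by positivity
  have z1 : p * q * q * (a.imJ * b.imK - a.imK * b.imJ) ^ 2 = 0 := by linarith
  have z2 : p * p * q * (a.imI * b.imK - a.imK * b.imI) ^ 2 = 0 := by linarith
  have z3 : p * q * (a.imI * b.imJ - a.imJ * b.imI) ^ 2 = 0 := by linarith
  simp [hp'.ne', hq'.ne', hp.ne', hq.ne'] at z1 z2 z3
  have g1 := h b.imI (-a.imI) (by ext <;> simp <;> linarith)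
  have g2 := h b.imJ (-a.imJ) (by ext <;> simp <;> linarith)
  have g3 := h b.imK (-a.imK) (by ext <;> simp <;> linarith)
  have := h 1 0 (by ext <;> simp <;> linarith)
  simp at this

end GrossAux

/-- `16p` divides `4D₁D₂ - Tr(x·ȳ)²`, whence `D₁D₂ - ¼Tr(x·ȳ)² ≥ 4p`. -/
theorem div_16p (p q : ℕ) (hp : Nat.Prime p) (hodd : Odd p) (hq : Nat.Prime q)
    (hq8 : q % 8 = 3) (hqr : ∃ r : ℤ, (q : ℤ) ∣ r ^ 2 + p)
    (O : Subring (Bq p q)) (hO : IsMaximalOrder O)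
    (D₁ D₂ : ℝ) (x y : Bq p q)
    (hm1 : SuccMin (GrossLat O) 1 D₁) (hm2 : SuccMin (GrossLat O) 2 D₂)
    (hx : x ∈ GrossLat O) (hy : y ∈ GrossLat O)
    (hxD : (Nrq x : ℝ) = D₁) (hyD : (Nrq y : ℝ) = D₂)
    (hxy : LinearIndependent ℚ ![x, y]) :
    (∃ n : ℤ, 0 < n ∧ ((16 * p : ℤ) ∣ n) ∧
      (n : ℝ) = 4 * D₁ * D₂ - (Trq (x * star y) : ℝ) ^ 2) ∧
    4 * (p : ℝ) ≤ D₁ * D₂ - (1 / 4) * (Trq (x * star y) : ℝ) ^ 2 := by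
  obtain ⟨a, ha, hxa⟩ := hx
  obtain ⟨b, hb, hyb⟩ := hy
  obtain ⟨z, hz, hdvd⟩ := GrossAux.comm_dvd p q hp hodd hq hq8 hqr O hO.1 a b ha hb
  have hpos := GrossAux.pos hp.pos hq.pos a b (by rw [← hxa, ← hyb]; exact hxy)
  have hE := GrossAux.gross_eq a b
  rw [← hxa, ← hyb] at hE
  rw [hz] at hpos hE
  have hz0 : 0 < z := by exact_mod_cast hpos
  have hE' := congrArg (fun t : ℚ => (t : ℝ)) hE
  push_cast at hE'
  rw [hxD, hyD] at hE'
  have hle : (p : ℝ) ≤ z := by exact_mod_cast Int.le_of_dvd hz0 hdvd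
  refine ⟨⟨16 * z, by omega, mul_dvd_mul_left 16 hdvd, ?_⟩, ?_⟩
  · push_cast
    rw [hE']
  · linarith
end
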